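/- arXiv:2212.12229 — 2 statements merged into one kernel-verified Lean document; each statement's English description precedes it below -/
import Mathlib

section
/- (Parseval frame property, Proposition 2.2(i).) For every f ∈ L²(ℝ^d), the family (|(G^A_{γ,γ*}, f)_{L²}|²)_{(γ,γ*)∈Γ̃} is summable and ∑_{(γ,γ*)∈Γ̃} |(G^A_{γ,γ*}, f)_{L²}|² = ‖f‖²_{L²(ℝ^d)}; equivalently, the map f ↦ ((G^A_{γ,γ*}, f)_{L²})_{(γ,γ*)∈Γ̃} is a linear isometry from L²(ℝ^d) into ℓ²(Γ̃). -/
open MeasureTheory Complex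
open scoped BigOperators ComplexConjugate ComplexInnerProductSpace

noncomputable section

/-- Euclidean dot product on `ℝ^d` (realized as `Fin d → ℝ`). -/
def dotR {d : ℕ} (x y : Fin d → ℝ) : ℝ := ∑ i, x i * y i

/-- Japanese bracket `⟨x⟩ = (1+|x|²)^(1/2)` (Euclidean norm). -/
def jap {d : ℕ} (x : Fin d → ℝ) : ℝ := Real.sqrt (1 + dotR x x)

/-- Euclidean norm on `ℝ^d`. -/
def enr {d : ℕ} (x : Fin d → ℝ) : ℝ := Real.sqrt (dotR x x)

/-- Embedding of the lattice `ℤ^d` into `ℝ^d`. -/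
def zToR {d : ℕ} (γ : Fin d → ℤ) : Fin d → ℝ := fun i => (γ i : ℝ)

/-- The point `2πk` of the dual lattice `(2πℤ)^d`, for `k ∈ ℤ^d`. -/
def dualV {d : ℕ} (k : Fin d → ℤ) : Fin d → ℝ := fun i => 2 * Real.pi * (k i : ℝ)

/-- The magnetic phase `Λ^A(x,y) = exp(−i ∫₀¹ ⟨A(x+t(y−x)), y−x⟩ dt)`. -/
def magPhase {d : ℕ} (A : (Fin d → ℝ) → (Fin d → ℝ)) (x y : Fin d → ℝ) : ℂ :=
  Complex.exp (-Complex.I *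
    ((∫ t in (0:ℝ)..1, dotR (A (x + t • (y - x))) (y - x)) : ℝ))

/-- The magnetic Gabor frame function
`G^A_{γ,γ*}(x) = Λ^A(x,γ) θ_{γ*}(x−γ) g(x−γ)` with `γ* = 2πk`. -/
def gaborF {d : ℕ} (A : (Fin d → ℝ) → (Fin d → ℝ)) (g : (Fin d → ℝ) → ℝ)
    (γ k : Fin d → ℤ) (x : Fin d → ℝ) : ℂ :=
  magPhase A x (zToR γ) * (((2 * Real.pi) ^ (-(d : ℝ) / 2) : ℝ) : ℂ) *
    Complex.exp (Complex.I * ((dotR (dualV k) (x - zToR γ) / (2 * Real.pi) : ℝ) : ℂ)) *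
    ((g (x - zToR γ) : ℝ) : ℂ)

/-- `g` is a smooth `[0,1]`-valued quadratic partition of unity with support in `(−1,1)^d`. -/
def IsQuadPartition {d : ℕ} (g : (Fin d → ℝ) → ℝ) : Prop :=
  ContDiff ℝ (⊤ : ℕ∞) g ∧ (∀ x, g x ∈ Set.Icc (0:ℝ) 1) ∧
    tsupport g ⊆ Set.univ.pi (fun _ : Fin d => Set.Ioo (-1:ℝ) 1) ∧
    ∀ x, HasSum (fun γ : Fin d → ℤ => (g (x - zToR γ)) ^ 2) 1

/-- Iterated directional derivative along a list of directions. -/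
def dList {E F : Type*} [NormedAddCommGroup E] [NormedSpace ℝ E]
    [NormedAddCommGroup F] [NormedSpace ℝ F] : List E → (E → F) → (E → F)
  | [], f => f
  | v :: L, f => fun x => fderiv ℝ (dList L f) x v

/-- Direction of differentiation in the first (position) variable. -/
def dirX {d : ℕ} (j : Fin d) : (Fin d → ℝ) × (Fin d → ℝ) := (Pi.single j 1, 0)

/-- Direction of differentiation in the second (momentum) variable. -/
def dirXi {d : ℕ} (j : Fin d) : (Fin d → ℝ) × (Fin d → ℝ) := (0, Pi.single j 1)

/-- The Hörmander class `S^p_0(ℝ^{2d})`. -/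
def HormClass (d : ℕ) (p : ℝ) (Φ : ((Fin d → ℝ) × (Fin d → ℝ)) → ℂ) : Prop :=
  ContDiff ℝ (⊤ : ℕ∞) Φ ∧
    ∀ a b : List (Fin d), ∃ C : ℝ,
      ∀ x ξ : Fin d → ℝ,
        ‖dList (a.map dirX ++ b.map dirXi) Φ (x, ξ)‖ ≤ C * jap ξ ^ p

/-- The magnetic field `B_{jk} = ∂_j A_k − ∂_k A_j` of a vector potential `A`. -/
def Bof {d : ℕ} (A : (Fin d → ℝ) → (Fin d → ℝ)) (j k : Fin d) (x : Fin d → ℝ) : ℝ :=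
  fderiv ℝ A x (Pi.single j 1) k - fderiv ℝ A x (Pi.single k 1) j

/-- Each component `B j k` is bounded together with all its partial derivatives. -/
def BBounded {d : ℕ} (B : Fin d → Fin d → (Fin d → ℝ) → ℝ) : Prop :=
  ∀ j k : Fin d, ∀ L : List (Fin d), ∃ C : ℝ,
    ∀ x, ‖dList (L.map (fun i => Pi.single i (1:ℝ))) (B j k) x‖ ≤ C

/-- Flux of `B` through the triangle with vertices `a, b, c`. -/
def fluxB {d : ℕ} (B : Fin d → Fin d → (Fin d → ℝ) → ℝ) (a b c : Fin d → ℝ) : ℝ :=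
  ∫ t in (0:ℝ)..1, ∫ s in (0:ℝ)..1,
    ∑ j, ∑ k, B j k (a + t • (b - a) + (s * t) • (c - b)) *
      ((b - a) j + s * (c - b) j) * (t * (c - b) k)

/-- `Ω^B(a,b,c) = exp(−i ∫_{⟨a,b,c⟩} B)`. -/
def OmegaB {d : ℕ} (B : Fin d → Fin d → (Fin d → ℝ) → ℝ) (a b c : Fin d → ℝ) : ℂ :=
  Complex.exp (-Complex.I * (fluxB B a b c : ℝ))


namespace UnitAddTorus

/-- **Parseval's identity** on the cube `(-1/2, 1/2]^d` for square integrable functions that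
vanish outside of it. -/
theorem hasSum_sq_integral_mFourier {ι : Type*} [Fintype ι] (φ : (ι → ℝ) → ℂ)
    (hφ : MemLp φ 2 volume)
    (hsupp : ∀ t, φ t ≠ 0 → ∀ i, t i ∈ Set.Ioc (-1 / 2 : ℝ) (-1 / 2 + 1)) :
    HasSum (fun n : ι → ℤ => ‖∫ t, mFourier (-n) (fun i => (t i : UnitAddCircle)) * φ t‖ ^ 2)
      (∫ t, ‖φ t‖ ^ 2) := by
  have hS : MeasurableSet {x : ι → ℝ | ∀ i, x i ∈ Set.Ioc (-1 / 2 : ℝ) (-1 / 2 + 1)} :=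
    MeasurableSet.univ_pi' fun _ => measurableSet_Ioc
  have hmem := ((hφ.restrict _).comp_measurePreserving
    (measurePreserving_subtype_coe hS)).comp_measurePreserving
    (measurePreserving_equivPiIoc fun _ : ι => (-1 / 2 : ℝ))
  have hcoe : ∀ t ∈ {x : ι → ℝ | ∀ i, x i ∈ Set.Ioc (-1 / 2 : ℝ) (-1 / 2 + 1)},
      ((φ ∘ Subtype.val) ∘ measurableEquivPiIoc fun _ : ι => (-1 / 2 : ℝ))
        (fun i => (t i : UnitAddCircle)) = φ t := by
    intro t ht
    have h := (measurableEquivPiIoc fun _ : ι => (-1 / 2 : ℝ)).apply_symm_apply ⟨t, ht⟩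
    exact congrArg (fun z => φ z.1) h
  have hzero : ∀ t, t ∉ {x : ι → ℝ | ∀ i, x i ∈ Set.Ioc (-1 / 2 : ℝ) (-1 / 2 + 1)} →
      φ t = 0 := fun t ht => by_contra fun h => ht (hsupp t h)
  have key := hasSum_sq_mFourierCoeff (hmem.toLp _)
  have hnorm := (integral_congr_ae (hmem.coeFn_toLp.fun_comp fun z : ℂ => ‖z‖ ^ 2)).trans <|
    (integral_preimage _ fun _ => (-1 / 2 : ℝ)).trans <|
    (setIntegral_congr_fun hS fun t ht => congrArg (fun z : ℂ => ‖z‖ ^ 2) (hcoe t ht)).trans <|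
    setIntegral_eq_integral_of_forall_compl_eq_zero fun t ht => by simp [hzero t ht]
  simp only [Function.comp_apply] at hnorm
  have hcoeff : ∀ n, mFourierCoeff (hmem.toLp _) n =
      ∫ t, mFourier (-n) (fun i => (t i : UnitAddCircle)) * φ t := by
    intro n
    have h1 : mFourierCoeff (hmem.toLp _) n = mFourierCoeff
        ((φ ∘ Subtype.val) ∘ measurableEquivPiIoc fun _ : ι => (-1 / 2 : ℝ)) n := by
      refine integral_congr_ae ?_
      filter_upwards [hmem.coeFn_toLp] with t ht
      rw [ht]
    rw [h1, mFourierCoeff_eq_integral _ n fun _ => (-1 / 2 : ℝ),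
      setIntegral_congr_fun hS fun t ht => congrArg (_ • ·) (hcoe t ht)]
    exact setIntegral_eq_integral_of_forall_compl_eq_zero fun t ht => by simp [hzero t ht]
  rw [hnorm] at key
  simpa only [hcoeff] using key

end UnitAddTorus

/-- **Parseval's identity** at scale `2π`: the normalized characters
`(2π)^(-d/2) exp(i⟨k, x⟩)` resolve square integrable functions supported in `(-1, 1)^d`. -/
theorem hasSum_sq_integral_exp {d : ℕ} (F : (Fin d → ℝ) → ℂ) (hF : MemLp F 2 volume)
    (hsupp : ∀ x, F x ≠ 0 → ∀ i, x i ∈ Set.Ioo (-1 : ℝ) 1) :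
    HasSum (fun k : Fin d → ℤ => ‖∫ x, (((2 * Real.pi) ^ (-(d : ℝ) / 2) : ℝ) : ℂ) *
        exp (-(I * ((dotR (dualV k) x / (2 * Real.pi) : ℝ) : ℂ))) * F x‖ ^ 2)
      (∫ x, ‖F x‖ ^ 2) := by
  have hpi : 0 < 2 * Real.pi := by positivity
  have hmem : MemLp (fun t => F ((2 * Real.pi) • t)) 2 volume := by
    refine MemLp.comp_of_map ?_ (measurable_const_smul (2 * Real.pi)).aemeasurable
    rw [Measure.map_addHaar_smul volume hpi.ne']
    exact hF.smul_measure ENNReal.ofReal_ne_top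
  have hcube : ∀ t, F ((2 * Real.pi) • t) ≠ 0 →
      ∀ i, t i ∈ Set.Ioc (-1 / 2 : ℝ) (-1 / 2 + 1) := by
    intro t ht i
    have h := hsupp _ ht i
    simp only [Pi.smul_apply, smul_eq_mul, Set.mem_Ioo] at h
    have := Real.pi_gt_three
    constructor <;> nlinarith
  have key := (UnitAddTorus.hasSum_sq_integral_mFourier _ hmem hcube).mul_left
    ((2 * Real.pi) ^ d)
  have hnorm := Measure.integral_comp_smul (volume : Measure (Fin d → ℝ))
    (fun x => ‖F x‖ ^ 2) (2 * Real.pi)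
  have hcoeff : ∀ k : Fin d → ℤ,
      ∫ t, UnitAddTorus.mFourier (-k) (fun i => (t i : UnitAddCircle)) * F ((2 * Real.pi) • t) =
      (((2 * Real.pi) ^ d)⁻¹ : ℝ) •
        ∫ x, exp (-(I * ((dotR (dualV k) x / (2 * Real.pi) : ℝ) : ℂ))) * F x := by
    intro k
    have h := Measure.integral_comp_smul (volume : Measure (Fin d → ℝ))
      (fun x => exp (-(I * ((dotR (dualV k) x / (2 * Real.pi) : ℝ) : ℂ))) * F x) (2 * Real.pi)
    rw [Module.finrank_fin_fun, abs_of_pos (by positivity)] at h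
    rw [← h]
    congr 1 with t
    congr 1
    simp only [UnitAddTorus.mFourier, ContinuousMap.coe_mk, fourier_coe_apply, ← exp_sum,
      dotR, dualV, Pi.smul_apply, smul_eq_mul, Pi.neg_apply]
    congr 1
    push_cast
    rw [Finset.sum_div, Finset.mul_sum, ← Finset.sum_neg_distrib]
    refine Finset.sum_congr rfl fun i _ => ?_
    field_simp
  rw [Module.finrank_fin_fun, abs_of_pos (by positivity)] at hnorm
  rw [hnorm, smul_eq_mul, mul_inv_cancel_left₀ (by positivity)] at key
  refine key.congr_fun fun k => ?_
  have hconst : ((2 * Real.pi) ^ (-(d : ℝ) / 2)) ^ 2 = ((2 * Real.pi) ^ d)⁻¹ := by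
    rw [← Real.rpow_natCast _ 2, ← Real.rpow_mul hpi.le, Nat.cast_ofNat,
      div_mul_cancel₀ _ two_ne_zero, Real.rpow_neg hpi.le, Real.rpow_natCast]
  simp_rw [mul_assoc (((2 * Real.pi) ^ (-(d : ℝ) / 2) : ℝ) : ℂ), integral_const_mul]
  rw [hcoeff, norm_smul, norm_mul, norm_real, mul_pow, Real.norm_eq_abs, sq_abs,
    hconst, Real.norm_of_nonneg (by positivity)]
  generalize hc : (2 * Real.pi) ^ d = c
  have hc0 : c ≠ 0 := hc ▸ (by positivity)
  field_simp

theorem continuous_dotR {d : ℕ} {X : Type*} [TopologicalSpace X] {u v : X → Fin d → ℝ}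
    (hu : Continuous u) (hv : Continuous v) : Continuous fun x => dotR (u x) (v x) := by
  unfold dotR
  fun_prop

theorem continuous_magPhase {d : ℕ} {A : (Fin d → ℝ) → (Fin d → ℝ)} (hA : Continuous A)
    (y : Fin d → ℝ) : Continuous fun x => magPhase A x y := by
  have h : Continuous fun x => ∫ t in (0 : ℝ)..1, dotR (A (x + t • (y - x))) (y - x) := by
    refine intervalIntegral.continuous_parametric_intervalIntegral_of_continuous' ?_ 0 1
    exact continuous_dotR (by fun_prop) (by fun_prop)
  unfold magPhase
  fun_prop

theorem norm_magPhase {d : ℕ} (A : (Fin d → ℝ) → (Fin d → ℝ)) (x y : Fin d → ℝ) :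
    ‖magPhase A x y‖ = 1 := by
  unfold magPhase
  rw [neg_mul, mul_comm, ← neg_mul, ← ofReal_neg, norm_exp_ofReal_mul_I]

/-- Parseval's identity for the frame functions localized at a fixed lattice point. -/
theorem hasSum_sq_inner_gaborF {d : ℕ} {A : (Fin d → ℝ) → (Fin d → ℝ)} (hA : Continuous A)
    {g : (Fin d → ℝ) → ℝ} (hg : Continuous g) (hbdd : ∀ x, g x ∈ Set.Icc (0 : ℝ) 1)
    (hsupp : tsupport g ⊆ Set.univ.pi fun _ : Fin d => Set.Ioo (-1 : ℝ) 1)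
    (f : (Fin d → ℝ) → ℂ) (hf : MemLp f 2 volume) (γ : Fin d → ℤ) :
    HasSum (fun k : Fin d → ℤ => ‖∫ x, conj (gaborF A g γ k x) * f x‖ ^ 2)
      (∫ x, g (x - zToR γ) ^ 2 * ‖f x‖ ^ 2) := by
  set F : (Fin d → ℝ) → ℂ := fun y =>
    (conj (magPhase A (y + zToR γ) (zToR γ)) * (g y : ℂ)) * f (y + zToR γ) with hFdef
  have hnorm : ∀ y, ‖F y‖ = g y * ‖f (y + zToR γ)‖ := by
    intro y
    simp [hFdef, norm_magPhase, abs_of_nonneg (hbdd y).1]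
  have hshift : MemLp (fun y => f (y + zToR γ)) 2 volume :=
    hf.comp_measurePreserving (measurePreserving_add_right volume (zToR γ))
  have hF : MemLp F 2 volume := by
    refine hshift.of_le (AEStronglyMeasurable.mul (Continuous.aestronglyMeasurable ?_) hshift.1)
      (.of_forall fun y => ?_)
    · have := continuous_magPhase hA (zToR γ)
      exact (continuous_conj.comp (this.comp (by fun_prop))).mul (by fun_prop)
    · rw [hnorm]
      exact mul_le_of_le_one_left (norm_nonneg _) (hbdd y).2
  have key := hasSum_sq_integral_exp F hF fun y hy i => by
    refine hsupp (subset_tsupport g fun h => hy ?_) i (Set.mem_univ i)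
    simp [hFdef, h]
  convert key using 1
  · ext k
    rw [← integral_add_right_eq_self _ (zToR γ)]
    congr 2
    refine integral_congr_ae (.of_forall fun y => ?_)
    simp only [gaborF, hFdef, map_mul, ← exp_conj, conj_ofReal, conj_I, add_sub_cancel_right,
      neg_mul]
    ring
  · rw [← integral_add_right_eq_self _ (zToR γ)]
    refine integral_congr_ae (.of_forall fun y => ?_)
    simp only [hnorm, mul_pow, add_sub_cancel_right]

/-- A quadratic partition of unity splits the integral of `‖f‖²`. -/
theorem hasSum_integral_sq_mul {d : ℕ} {g : (Fin d → ℝ) → ℝ} (hg : Continuous g)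
    (hsum : ∀ x, HasSum (fun γ : Fin d → ℤ => g (x - zToR γ) ^ 2) 1)
    (f : (Fin d → ℝ) → ℂ) (hf : MemLp f 2 volume) :
    HasSum (fun γ : Fin d → ℤ => ∫ x, g (x - zToR γ) ^ 2 * ‖f x‖ ^ 2) (∫ x, ‖f x‖ ^ 2) := by
  have hs : ∀ x, HasSum (fun γ : Fin d → ℤ => g (x - zToR γ) ^ 2 * ‖f x‖ ^ 2) (‖f x‖ ^ 2) :=
    fun x => by simpa using (hsum x).mul_right (‖f x‖ ^ 2)
  refine hasSum_integral_of_dominated_convergence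
    (fun γ x => g (x - zToR γ) ^ 2 * ‖f x‖ ^ 2) (fun γ => ?_)
    (fun γ => .of_forall fun x => ?_) (.of_forall fun x => (hs x).summable) ?_ (.of_forall hs)
  · refine AEStronglyMeasurable.mul (Continuous.aestronglyMeasurable (by fun_prop)) ?_
    exact hf.1.norm.pow 2
  · exact (Real.norm_of_nonneg (by positivity)).le
  · simpa only [(hs _).tsum_eq] using hf.norm.integrable_sq

/-- **Parseval frame property** (Proposition 2.2(i)): for every `f ∈ L²(ℝ^d)`, the squared
moduli of the magnetic Gabor coefficients `(G^A_{γ,γ*}, f)_{L²}` are summable with sum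
`‖f‖²_{L²}`; i.e. `f ↦ ((G^A_{γ,γ*}, f))_{(γ,γ*)}` is an isometry into `ℓ²(Γ̃)`. Here the
frame is indexed by `(γ, k) ∈ ℤ^d × ℤ^d`, with dual-lattice point `γ* = 2πk`, and `G` is
the family of `L²`-classes of the frame functions `gaborF A g γ k`. -/
theorem gabor_parseval_frame (d : ℕ) (hd : 1 ≤ d)
    (A : (Fin d → ℝ) → (Fin d → ℝ)) (hA : Function.HasTemperateGrowth A)
    (g : (Fin d → ℝ) → ℝ) (hg : IsQuadPartition g)
    (G : ((Fin d → ℤ) × (Fin d → ℤ)) → Lp ℂ 2 (volume : Measure (Fin d → ℝ)))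
    (hG : ∀ γ k : Fin d → ℤ, (G (γ, k) : (Fin d → ℝ) → ℂ) =ᵐ[volume] gaborF A g γ k)
    (f : Lp ℂ 2 (volume : Measure (Fin d → ℝ))) :
    HasSum (fun gk : (Fin d → ℤ) × (Fin d → ℤ) => ‖(⟪G gk, f⟫ : ℂ)‖ ^ 2) (‖f‖ ^ 2) := by
  obtain ⟨hsmooth, hbdd, hsupp, hsum⟩ := hg
  have hinner : ∀ γ k, (⟪G (γ, k), f⟫ : ℂ) = ∫ x, conj (gaborF A g γ k x) * f x := by
    intro γ k
    rw [L2.inner_def]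
    refine integral_congr_ae ?_
    filter_upwards [hG γ k] with x hx
    rw [hx, RCLike.inner_apply, mul_comm]
  have hnorm : ‖f‖ ^ 2 = ∫ x, ‖f x‖ ^ 2 := by
    rw [← inner_self_eq_norm_sq (𝕜 := ℂ), L2.inner_def,
      ← integral_re (L2.integrable_inner f f)]
    simp only [inner_self_eq_norm_sq]
  have hfib : ∀ γ, HasSum (fun k => ‖(⟪G (γ, k), f⟫ : ℂ)‖ ^ 2)
      (∫ x, g (x - zToR γ) ^ 2 * ‖f x‖ ^ 2) := fun γ => by
    simpa only [hinner] using hasSum_sq_inner_gaborF hA.1.continuous hsmooth.continuous hbdd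
      hsupp f (Lp.memLp f) γ
  have htot := hasSum_integral_sq_mul hsmooth.continuous hsum f (Lp.memLp f)
  have hsummable : Summable fun gk : (Fin d → ℤ) × (Fin d → ℤ) => ‖(⟪G gk, f⟫ : ℂ)‖ ^ 2 := by
    refine (summable_prod_of_nonneg fun _ => by positivity).2
      ⟨fun γ => (hfib γ).summable, ?_⟩
    simpa only [(hfib _).tsum_eq] using htot.summable
  rw [hnorm, htot.unique (hsummable.hasSum.prod_fiberwise hfib)]
  exact hsummable.hasSum
end
end

section
/- (Theorem 3.1, direction (i)⇒(ii): off-diagonal decay of the magnetic Gabor matrix of a Hörmander-class operator.) Let p ∈ ℝ and Φ ∈ S^p_0(ℝ^{2d}). Then for all α̃=(α,α*), β̃=(β,β*) ∈ Γ̃ the function η ↦ I_{α̃,β̃}(η) is Lebesgue-integrable on ℝ^d, so the matrix elements M_{α̃,β̃} := ∫_{ℝ^d} I_{α̃,β̃}(η) dη are well defined; moreover, for every (n₁,n₂) ∈ ℕ² there exists a constant C(n₁,n₂) > 0 such that ⟨α−β⟩^{n₁} ⟨α*−β*⟩^{n₂} ⟨α*+β*⟩^{−p} |M_{α̃,β̃}|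 ≤ C(n₁,n₂) for all α̃, β̃ ∈ Γ̃. -/
open MeasureTheory Complex
open scoped BigOperators ComplexConjugate ComplexInnerProductSpace

noncomputable section

/-- The integrand (as a function of the momentum variable `η`) of the Gabor matrix element
`M_{(α,2πk),(β,2πk')} = ∫ I(η) dη` of `Op^A(Φ)`, the `(x,y)`-integral being written as a
single Bochner integral over `ℝ^d × ℝ^d`. -/
def Ifun {d : ℕ} (A : (Fin d → ℝ) → (Fin d → ℝ)) (g : (Fin d → ℝ) → ℝ)
    (Φ : ((Fin d → ℝ) × (Fin d → ℝ)) → ℂ) (α αs β βs : Fin d → ℤ) (η : Fin d → ℝ) : ℂ :=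
  (((2 * Real.pi) ^ d : ℝ)⁻¹ : ℂ) *
    ∫ w : (Fin d → ℝ) × (Fin d → ℝ),
      magPhase A (zToR α) w.1 *
      Complex.exp (-Complex.I * ((dotR (dualV αs) (w.1 - zToR α) / (2 * Real.pi) : ℝ) : ℂ)) *
      (g (w.1 - zToR α) : ℂ) *
      magPhase A w.1 w.2 *
      Complex.exp (Complex.I * ((dotR η (w.1 - w.2) : ℝ) : ℂ)) *
      Φ ((2:ℝ)⁻¹ • (w.1 + w.2), η) *
      magPhase A w.2 (zToR β) *
      Complex.exp (Complex.I * ((dotR (dualV βs) (w.2 - zToR β) / (2 * Real.pi) : ℝ) : ℂ)) *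
      (g (w.2 - zToR β) : ℂ)

open scoped ContDiff

section Calculus

open Set Topology

universe u

variable {ι : Type*} {E : Type u} [NormedAddCommGroup E] [NormedSpace ℝ E]
  {G : Type*} [NormedAddCommGroup G] [NormedSpace ℝ G]

/-- Differentiation under an integral over a compact set, for jointly `C¹` integrands. -/
lemma hasFDerivAt_setIntegral_of_isCompact [FiniteDimensional ℝ E]
    {F X : Type*} [NormedAddCommGroup F] [NormedSpace ℝ F]
    [NormedAddCommGroup X] [MeasurableSpace X] [BorelSpace X] [SecondCountableTopology X]
    {μ : Measure X} [IsFiniteMeasureOnCompacts μ] {K : Set X} (hK : IsCompact K)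
    {H : X → E → F} {H' : X → E → E →L[ℝ] F}
    (hd : ∀ x z, HasFDerivAt (H x) (H' x z) z)
    (hc : Continuous fun q : X × E => H q.1 q.2)
    (hc' : Continuous fun q : X × E => H' q.1 q.2) (z : E) :
    HasFDerivAt (fun z => ∫ x in K, H x z ∂μ) (∫ x in K, H' x z ∂μ) z := by
  have : ProperSpace E := FiniteDimensional.proper_real E
  obtain ⟨C, hC⟩ := (hK.prod (isCompact_closedBall z 1)).exists_bound_of_continuousOn
    hc'.continuousOn
  have h1 : ∀ y, Continuous fun x => H x y := fun y => by fun_prop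
  have h2 : Continuous fun x => H' x z := by fun_prop
  refine hasFDerivAt_integral_of_dominated_of_fderiv_le (F := fun z x => H x z)
    (F' := fun z x => H' x z) (bound := fun _ => C)
    (Metric.closedBall_mem_nhds z one_pos) ?_ ?_ ?_ ?_ ?_ ?_
  · exact Filter.Eventually.of_forall fun y => (h1 y).aestronglyMeasurable
  · exact (h1 z).continuousOn.integrableOn_compact hK
  · exact h2.aestronglyMeasurable
  · exact (ae_restrict_iff' hK.measurableSet).2
      (Filter.Eventually.of_forall fun x hx y hy => hC (x, y) ⟨hx, hy⟩)
  · exact continuousOn_const.integrableOn_compact hK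
  · exact Filter.Eventually.of_forall fun x y _ => hd x y

lemma hasFDerivAt_setIntegral_of_contDiff [FiniteDimensional ℝ E]
    {F X : Type*} [NormedAddCommGroup F] [NormedSpace ℝ F]
    [NormedAddCommGroup X] [NormedSpace ℝ X] [MeasurableSpace X] [BorelSpace X]
    [SecondCountableTopology X]
    {μ : Measure X} [IsFiniteMeasureOnCompacts μ] {K : Set X} (hK : IsCompact K)
    {H : X → E → F} (hH : ContDiff ℝ ∞ fun q : X × E => H q.1 q.2) (z : E) :
    HasFDerivAt (fun z => ∫ x in K, H x z ∂μ) (∫ x in K, fderiv ℝ (H x) z ∂μ) z := by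
  have h1 : ∀ x, ContDiff ℝ ∞ (H x) := fun x => hH.comp (contDiff_prodMk_right x)
  have h2 : ContDiff ℝ 0 fun q : X × E => fderiv ℝ (H q.1) q.2 :=
    ContDiff.fderiv (m := ∞) (f := fun q : X × E => H q.1)
      (hH.comp ((contDiff_fst.comp contDiff_fst).prodMk contDiff_snd)) contDiff_snd (by simp)
  exact hasFDerivAt_setIntegral_of_isCompact hK
    (fun x z => ((h1 x).differentiable (by simp) z).hasFDerivAt) hH.continuous h2.continuous z

lemma contDiff_setIntegral_nat [FiniteDimensional ℝ E]
    {X : Type*} [NormedAddCommGroup X] [NormedSpace ℝ X] [MeasurableSpace X] [BorelSpace X]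
    [SecondCountableTopology X]
    {μ : Measure X} [IsFiniteMeasureOnCompacts μ] {K : Set X} (hK : IsCompact K) (n : ℕ) :
    ∀ {F : Type u} [NormedAddCommGroup F] [NormedSpace ℝ F] {H : X → E → F}
      (_ : ContDiff ℝ ∞ fun q : X × E => H q.1 q.2),
      ContDiff ℝ n (fun z => ∫ x in K, H x z ∂μ) ∧
      ∀ z C, (∀ x ∈ K, ‖iteratedFDeriv ℝ n (H x) z‖ ≤ C) →
        ‖iteratedFDeriv ℝ n (fun z => ∫ x in K, H x z ∂μ) z‖ ≤ C * μ.real K := by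
  induction n with
  | zero =>
    intro F _ _ H hH
    refine ⟨contDiff_zero.2 (continuous_iff_continuousAt.2 fun z =>
      (hasFDerivAt_setIntegral_of_contDiff hK hH z).continuousAt), fun z C hC => ?_⟩
    rw [norm_iteratedFDeriv_zero]
    exact norm_setIntegral_le_of_norm_le_const hK.measure_lt_top
      fun x hx => by simpa using hC x hx
  | succ n ih =>
    intro F _ _ H hH
    have hder := hasFDerivAt_setIntegral_of_contDiff (μ := μ) hK hH
    have h2 : ContDiff ℝ ∞ fun q : X × E => fderiv ℝ (H q.1) q.2 :=
      ContDiff.fderiv (m := ∞) (f := fun q : X × E => H q.1)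
        (hH.comp ((contDiff_fst.comp contDiff_fst).prodMk contDiff_snd)) contDiff_snd (by simp)
    obtain ⟨i1, i2⟩ := ih (H := fun x z => fderiv ℝ (H x) z) h2
    have hfd : fderiv ℝ (fun z => ∫ x in K, H x z ∂μ) = fun z => ∫ x in K, fderiv ℝ (H x) z ∂μ :=
      funext fun z => (hder z).fderiv
    refine ⟨?_, fun z C hC => ?_⟩
    · push_cast
      refine contDiff_succ_iff_fderiv.2 ⟨fun z => (hder z).differentiableAt, by simp, ?_⟩
      rw [hfd]; exact i1
    · rw [← norm_iteratedFDeriv_fderiv, hfd]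
      exact i2 z C fun x hx => by
        have := hC x hx
        rwa [← norm_iteratedFDeriv_fderiv] at this

lemma dList_fderiv {F : Type*} [NormedAddCommGroup F] [NormedSpace ℝ F] (L : List E) (v : E)
    (f : E → F) : dList L (fun z => fderiv ℝ f z v) = dList (L ++ [v]) f := by
  induction L with
  | nil => rfl
  | cons a L ih => simp only [List.cons_append, dList, ih]

/-- A family of smooth functions on `E`, whose derivatives of order at most `m` are bounded on `K`
by a multiple of the weight `w`, uniformly over the family. -/
def SymbolBound {F : Type*} [NormedAddCommGroup F] [NormedSpace ℝ F]
    (K : Set E) (m : ℕ) (w : ι → ℝ) (f : ι → E → F) : Prop :=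
  (∀ i, ContDiff ℝ ∞ (f i)) ∧ ∃ C, 0 ≤ C ∧ ∀ i, ∀ z ∈ K, ∀ n ≤ m,
    ‖iteratedFDeriv ℝ n (f i) z‖ ≤ C * w i

namespace SymbolBound

variable {F : Type*} [NormedAddCommGroup F] [NormedSpace ℝ F] {K : Set E} {m : ℕ} {w w' : ι → ℝ}

lemma mono {f : ι → E → F} (hf : SymbolBound K m w f) (h : ∀ i, w i ≤ w' i) :
    SymbolBound K m w' f := by
  obtain ⟨h1, C, hC, h2⟩ := hf
  exact ⟨h1, C, hC, fun i z hz n hn =>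
    (h2 i z hz n hn).trans (mul_le_mul_of_nonneg_left (h i) hC)⟩

lemma reindex {κ : Type*} {f : ι → E → F} (hf : SymbolBound K m w f) (φ : κ → ι) :
    SymbolBound K m (fun i => w (φ i)) (fun i => f (φ i)) := by
  obtain ⟨h1, C, hC, h2⟩ := hf
  exact ⟨fun i => h1 _, C, hC, fun i => h2 _⟩

lemma mul {A : Type*} [NormedRing A] [NormedAlgebra ℝ A] {f g : ι → E → A}
    (hf : SymbolBound K m w f) (hg : SymbolBound K m w' g) :
    SymbolBound K m (fun i => w i * w' i) (fun i z => f i z * g i z) := by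
  obtain ⟨f1, C, hC, f2⟩ := hf
  obtain ⟨g1, D, hD, g2⟩ := hg
  refine ⟨fun i => (f1 i).mul (g1 i), 2 ^ m * (C * D), by positivity, fun i z hz n hn => ?_⟩
  have a0 : 0 ≤ C * w i := (norm_nonneg _).trans (f2 i z hz 0 (Nat.zero_le _))
  have b0 : 0 ≤ D * w' i := (norm_nonneg _).trans (g2 i z hz 0 (Nat.zero_le _))
  calc ‖iteratedFDeriv ℝ n (fun z => f i z * g i z) z‖
      ≤ ∑ j ∈ Finset.range (n + 1), (n.choose j : ℝ) * ‖iteratedFDeriv ℝ j (f i) z‖ *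
          ‖iteratedFDeriv ℝ (n - j) (g i) z‖ :=
        norm_iteratedFDeriv_mul_le (f1 i) (g1 i) z (by exact_mod_cast le_top)
    _ ≤ ∑ j ∈ Finset.range (n + 1), (n.choose j : ℝ) * (C * w i) * (D * w' i) := by
        gcongr with j hj
        · exact f2 i z hz j (by simp at hj; omega)
        · exact g2 i z hz (n - j) (by omega)
    _ = 2 ^ n * ((C * w i) * (D * w' i)) := by
        rw [← Finset.sum_mul, ← Finset.sum_mul, ← Nat.cast_sum, Nat.sum_range_choose]
        push_cast; ring
    _ ≤ 2 ^ m * ((C * w i) * (D * w' i)) := by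
        gcongr; norm_num
    _ = _ := by ring

lemma add {f g : ι → E → F} (hf : SymbolBound K m w f) (hg : SymbolBound K m w g) :
    SymbolBound K m w (fun i z => f i z + g i z) := by
  obtain ⟨f1, C, hC, f2⟩ := hf
  obtain ⟨g1, D, hD, g2⟩ := hg
  refine ⟨fun i => (f1 i).add (g1 i), C + D, by positivity, fun i z hz n hn => ?_⟩
  have : iteratedFDeriv ℝ n (fun z => f i z + g i z) z =
      iteratedFDeriv ℝ n (f i) z + iteratedFDeriv ℝ n (g i) z :=
    iteratedFDeriv_add_apply ((f1 i).contDiffAt.of_le (by exact_mod_cast le_top))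
      ((g1 i).contDiffAt.of_le (by exact_mod_cast le_top))
  rw [this, add_mul]
  exact (norm_add_le _ _).trans (add_le_add (f2 i z hz n hn) (g2 i z hz n hn))

lemma const (c : ι → F) (h : ∀ i, ‖c i‖ ≤ w i) : SymbolBound K m w (fun i _ => c i) := by
  refine ⟨fun i => contDiff_const, 1, zero_le_one, fun i z _ n _ => ?_⟩
  rcases Nat.eq_zero_or_pos n with rfl | hn
  · simpa using h i
  · rw [iteratedFDeriv_const_of_ne hn.ne']
    simpa using (norm_nonneg _).trans (h i)

lemma zero (hw : ∀ i, 0 ≤ w i) : SymbolBound K m w (fun _ _ => (0 : F)) :=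
  const _ fun i => by simpa using hw i

lemma sum {κ : Type*} (s : Finset κ) {f : κ → ι → E → F} (hw : ∀ i, 0 ≤ w i)
    (h : ∀ k ∈ s, SymbolBound K m w (f k)) :
    SymbolBound K m w (fun i z => ∑ k ∈ s, f k i z) := by
  classical
  induction s using Finset.induction_on with
  | empty => simpa using zero hw
  | insert a s ha ih =>
    simp only [Finset.sum_insert ha]
    exact (h a (by simp)).add (ih fun k hk => h k (by simp [hk]))

/-- A single smooth function, seen as a constant family, is bounded on compact sets. -/
lemma of_isCompact (hK : IsCompact K) {f : E → F} (hf : ContDiff ℝ ∞ f) :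
    SymbolBound K m (fun _ : ι => (1 : ℝ)) (fun _ => f) := by
  refine ⟨fun _ => hf, ?_⟩
  have : ∀ n : ℕ, ∃ C, 0 ≤ C ∧ ∀ z ∈ K, ‖iteratedFDeriv ℝ n f z‖ ≤ C := fun n => by
    obtain ⟨C, hC⟩ := hK.exists_bound_of_continuousOn
      (hf.continuous_iteratedFDeriv (m := n) (by exact_mod_cast le_top)).continuousOn
    exact ⟨max C 0, le_max_right _ _, fun z hz => (hC z hz).trans (le_max_left _ _)⟩
  choose C hC h using this
  refine ⟨∑ n ∈ Finset.range (m + 1), C n, Finset.sum_nonneg fun n _ => hC n,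
    fun _ z hz n hn => ?_⟩
  rw [mul_one]
  exact (h n z hz).trans (Finset.single_le_sum (f := C) (fun n _ => hC n)
    (Finset.mem_range.2 (by omega)))

lemma comp_affine {f : ι → E → F} (hf : SymbolBound univ m w f) (L : ι → G →L[ℝ] E) (c : ι → E)
    (R : ℝ) (hL : ∀ i, ‖L i‖ ≤ R) (K : Set G) :
    SymbolBound K m w (fun i z => f i (c i + L i z)) := by
  obtain ⟨f1, C, hC, f2⟩ := hf
  have f3 : ∀ i, ContDiff ℝ ∞ fun x => f i (c i + x) := fun i =>
    (f1 i).comp (contDiff_const.add contDiff_id)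
  refine ⟨fun i => (f3 i).comp (L i).contDiff, C * (max R 1) ^ m, by positivity,
    fun i z _ n hn => ?_⟩
  have key : iteratedFDeriv ℝ n (fun z => f i (c i + L i z)) z =
      (iteratedFDeriv ℝ n (f i) (c i + L i z)).compContinuousLinearMap fun _ => L i := by
    have := (L i).iteratedFDeriv_comp_right (f3 i) z (i := n) (by exact_mod_cast le_top)
    rw [iteratedFDeriv_comp_add_left] at this
    exact this
  rw [key]
  have b0 := f2 i (c i + L i z) (mem_univ _) n hn
  calc _ ≤ ‖iteratedFDeriv ℝ n (f i) (c i + L i z)‖ * ∏ _j : Fin n, ‖L i‖ :=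
        ContinuousMultilinearMap.norm_compContinuousLinearMap_le _ _
    _ ≤ (C * w i) * (max R 1) ^ m := by
        rw [Finset.prod_const, Finset.card_univ, Fintype.card_fin]
        gcongr
        · exact (norm_nonneg _).trans b0
        · calc ‖L i‖ ^ n ≤ (max R 1) ^ n := by gcongr; exact (hL i).trans (le_max_left _ _)
            _ ≤ (max R 1) ^ m := by gcongr; exact le_max_right _ _
    _ = _ := by ring

lemma const_add_clm (hK : IsCompact K) (L : E →L[ℝ] F) (c : ι → F)
    (hc : ∀ i, ‖c i‖ ≤ w i) (hw : ∀ i, 1 ≤ w i) :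
    SymbolBound K m w (fun i z => c i + L z) :=
  (const c hc).add ((of_isCompact hK L.contDiff).mono hw)

/-- Bounds on the partial derivatives along a basis give bounds on the Fréchet derivative. -/
lemma fderiv_of_basis {κ : Type*} [Fintype κ] [FiniteDimensional ℝ E] (b : Module.Basis κ ℝ E)
    {f : ι → E → F} (hw : ∀ i, 0 ≤ w i)
    (h : ∀ k, SymbolBound K m w (fun i z => fderiv ℝ (f i) z (b k))) :
    SymbolBound K m w (fun i => fderiv ℝ (f i)) := by
  classical
  let e : κ → E →L[ℝ] ℝ := fun k => LinearMap.toContinuousLinearMap (b.coord k)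
  let T : κ → F →L[ℝ] (E →L[ℝ] F) := fun k => ContinuousLinearMap.smulRightL ℝ E F (e k)
  have hfd : (fun i => fderiv ℝ (f i)) = fun i z => ∑ k, T k (fderiv ℝ (f i) z (b k)) := by
    funext i z; ext v
    have := congrArg (fderiv ℝ (f i) z) (b.sum_repr v)
    rw [map_sum] at this
    simp [T, e, ← this]
  rw [hfd]
  refine sum Finset.univ hw fun k _ => ?_
  obtain ⟨f1, C, hC, f2⟩ := h k
  refine ⟨fun i => (T k).contDiff.comp (f1 i), ‖T k‖ * C, by positivity, fun i z hz n hn => ?_⟩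
  rw [mul_assoc]
  exact ((T k).norm_iteratedFDeriv_comp_left ((f1 i).contDiffAt (x := z))
    (by exact_mod_cast le_top)).trans (by gcongr; exact f2 i z hz n hn)

/-- Bounds on all iterated directional derivatives along a basis bound the whole family. -/
lemma of_dList {κ : Type*} [Fintype κ] [FiniteDimensional ℝ E] (b : Module.Basis κ ℝ E)
    (hw : ∀ i, 0 ≤ w i) (m : ℕ) : ∀ {f : ι → E → F}, (∀ i, ContDiff ℝ ∞ (f i)) →
    (∀ L : List κ, ∃ C, ∀ i, ∀ z ∈ K, ‖dList (L.map b) (f i) z‖ ≤ C * w i) →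
    SymbolBound K m w f := by
  have h0 : ∀ {f : ι → E → F},
      (∀ L : List κ, ∃ C, ∀ i, ∀ z ∈ K, ‖dList (L.map b) (f i) z‖ ≤ C * w i) →
      ∃ C, 0 ≤ C ∧ ∀ i, ∀ z ∈ K, ‖f i z‖ ≤ C * w i := by
    intro f h
    obtain ⟨C, hC⟩ := h []
    exact ⟨max C 0, le_max_right _ _, fun i z hz => (hC i z hz).trans
      (mul_le_mul_of_nonneg_right (le_max_left _ _) (hw i))⟩
  induction m with
  | zero =>
    intro f hf h
    obtain ⟨C, hC, h⟩ := h0 h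
    refine ⟨hf, C, hC, fun i z hz n hn => ?_⟩
    obtain rfl : n = 0 := by omega
    simpa using h i z hz
  | succ m ih =>
    intro f hf h
    have hd : SymbolBound K m w (fun i => fderiv ℝ (f i)) := by
      refine fderiv_of_basis b hw fun k => ih (fun i => ?_) fun L => ?_
      · exact ((hf i).fderiv_right (m := ∞) (by simp)).clm_apply contDiff_const
      · obtain ⟨C, hC⟩ := h (L ++ [k])
        exact ⟨C, fun i z hz => by rw [dList_fderiv]; simpa using hC i z hz⟩
    obtain ⟨-, D, hD, hd⟩ := hd
    obtain ⟨C, hC, h0⟩ := h0 h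
    refine ⟨hf, C + D, by positivity, fun i z hz n hn => ?_⟩
    rw [add_mul]
    rcases n with _ | n
    · rw [norm_iteratedFDeriv_zero]
      exact (h0 i z hz).trans (le_add_of_nonneg_right (mul_nonneg hD (hw i)))
    · rw [← norm_iteratedFDeriv_fderiv]
      exact (hd i z hz n (by omega)).trans (le_add_of_nonneg_left (mul_nonneg hC (hw i)))

lemma setIntegral [FiniteDimensional ℝ E] {F : Type u} [NormedAddCommGroup F] [NormedSpace ℝ F]
    {S : Set ℝ} (hS : IsCompact S) {H : ι → ℝ → E → F}
    (hH : ∀ i, ContDiff ℝ ∞ fun q : ℝ × E => H i q.1 q.2)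
    (h : SymbolBound K m (fun q : ι × S => w q.1) (fun q z => H q.1 q.2 z)) :
    SymbolBound K m w (fun i z => ∫ t in S, H i t z) := by
  obtain ⟨-, C, hC, h⟩ := h
  refine ⟨fun i => contDiff_infty.2 fun n => (contDiff_setIntegral_nat hS n (hH i)).1,
    C * volume.real S, by positivity, fun i z hz n hn => ?_⟩
  have := (contDiff_setIntegral_nat (μ := volume) hS n (hH i)).2 z (C * w i)
    fun t ht => h (i, ⟨t, ht⟩) z hz n hn
  linarith

/-- If the derivatives of positive order of the real family `ψ` are controlled by `w`,
then `exp (-i ψ)` is controlled by a power of `w`. -/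
lemma cexp_neg_I_mul {ψ : ι → E → ℝ} (hψ : ∀ i, ContDiff ℝ ∞ (ψ i)) (hw : ∀ i, 1 ≤ w i)
    (h : ∃ C, ∀ i, ∀ z ∈ K, ∀ n, 1 ≤ n → n ≤ m → ‖iteratedFDeriv ℝ n (ψ i) z‖ ≤ C * w i) :
    SymbolBound K m (fun i => w i ^ m) (fun i z => cexp (-I * (ψ i z : ℂ))) := by
  obtain ⟨C, h⟩ := h
  let e : ℝ → ℂ := fun s => cexp (-I * (s : ℂ))
  have he : ContDiff ℝ ∞ e := (contDiff_const.mul ofRealCLM.contDiff).cexp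
  have hed : ∀ n : ℕ, iteratedDeriv n e = fun s => (-I) ^ n * e s := by
    intro n
    induction n with
    | zero => simp
    | succ n ih =>
      rw [iteratedDeriv_succ, ih]
      funext s
      have h1 : HasDerivAt (fun s : ℝ => -I * (s : ℂ)) (-I) s := by
        simpa using (ofRealCLM.hasDerivAt (x := s)).const_mul (-I)
      have := (h1.cexp.const_mul ((-I) ^ n)).deriv
      rw [this, pow_succ]
      ring
  have hen : ∀ n s, ‖iteratedFDeriv ℝ n e s‖ ≤ 1 := by
    intro n s
    rw [norm_iteratedFDeriv_eq_norm_iteratedDeriv, hed]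
    have : ‖e s‖ = 1 := by
      have := norm_exp_ofReal_mul_I (-s)
      rw [← this]; simp only [e]; congr 2; push_cast; ring
    simp [this]
  refine ⟨fun i => he.comp (hψ i), m.factorial * (max C 1) ^ m, by positivity,
    fun i z hz n hn => ?_⟩
  have hD : 1 ≤ max C 1 * w i := one_le_mul_of_one_le_of_one_le (le_max_right _ _) (hw i)
  have := norm_iteratedFDeriv_comp_le he (hψ i) (n := n) (by exact_mod_cast le_top) z
    (C := 1) (D := max C 1 * w i) (fun j _ => hen j _) (fun j h1 h2 => by
      calc _ ≤ C * w i := h i z hz j h1 (h2.trans hn)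
        _ ≤ max C 1 * w i := by gcongr; exacts [zero_le_one.trans (hw i), le_max_left _ _]
        _ ≤ _ := le_self_pow₀ hD (by omega))
  calc _ ≤ (n.factorial : ℝ) * 1 * (max C 1 * w i) ^ n := this
    _ ≤ m.factorial * 1 * (max C 1 * w i) ^ m := by
        gcongr
    _ = _ := by rw [mul_pow]; ring

end SymbolBound

end Calculus

section Phase

open Set

variable {d : ℕ}

/-- The dot product as a continuous bilinear map. -/
def dotL (d : ℕ) : (Fin d → ℝ) →L[ℝ] (Fin d → ℝ) →L[ℝ] ℝ :=
  ∑ i, (ContinuousLinearMap.mul ℝ ℝ).bilinearComp (ContinuousLinearMap.proj i)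
    (ContinuousLinearMap.proj i)

lemma dotL_apply (x y : Fin d → ℝ) : dotL d x y = dotR x y := by
  simp [dotL, dotR]

/-- The circulation of `A` along the segment from `x` to `y`. -/
def segmentCirculation (A : (Fin d → ℝ) → (Fin d → ℝ)) (x y : Fin d → ℝ) : ℝ :=
  ∫ t in (0:ℝ)..1, dotR (A (x + t • (y - x))) (y - x)

lemma segmentCirculation_eq (A : (Fin d → ℝ) → (Fin d → ℝ)) (x y : Fin d → ℝ) :
    segmentCirculation A x y =
      ∫ t in Icc (0:ℝ) 1, dotL d (A (x + t • (y - x))) (y - x) := by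
  rw [segmentCirculation, intervalIntegral.integral_of_le zero_le_one, integral_Icc_eq_integral_Ioc]
  simp only [dotL_apply]

lemma contDiff_Bof {A : (Fin d → ℝ) → (Fin d → ℝ)} (hA : ContDiff ℝ ∞ A) (j k : Fin d) :
    ContDiff ℝ ∞ (Bof A j k) := by
  have h : ∀ j k : Fin d, ContDiff ℝ ∞ fun x => fderiv ℝ A x (Pi.single j 1) k := fun j k =>
    contDiff_pi.1 ((hA.fderiv_right (m := ∞) (by simp)).clm_apply contDiff_const) k
  exact (h j k).sub (h k j)

lemma sum_Bof_mul {A : (Fin d → ℝ) → (Fin d → ℝ)} (x a b : Fin d → ℝ) :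
    ∑ j, ∑ k, Bof A j k x * (a j * b k) =
      dotL d (fderiv ℝ A x a) b - dotL d (fderiv ℝ A x b) a := by
  have h : ∀ a b : Fin d → ℝ, dotL d (fderiv ℝ A x a) b =
      ∑ j, ∑ k, fderiv ℝ A x (Pi.single j 1) k * (a j * b k) := by
    intro a b
    have ha : a = ∑ j, a j • (Pi.single j 1 : Fin d → ℝ) := by
      ext i; simp [Finset.sum_apply, Pi.single_apply]
    have h1 : fderiv ℝ A x a = ∑ j, a j • fderiv ℝ A x (Pi.single j 1) := by
      conv_lhs => rw [ha]
      simp only [map_sum, map_smul]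
    rw [h1, dotL_apply, dotR, Finset.sum_comm]
    refine Finset.sum_congr rfl fun k _ => ?_
    rw [Finset.sum_apply, Finset.sum_mul]
    refine Finset.sum_congr rfl fun j _ => ?_
    simp only [Pi.smul_apply, smul_eq_mul]; ring
  rw [h a b, h b a, Finset.sum_comm (f := fun j k => fderiv ℝ A x (Pi.single j 1) k * (b j * a k)),
    ← Finset.sum_sub_distrib]
  refine Finset.sum_congr rfl fun j _ => ?_
  rw [← Finset.sum_sub_distrib]
  refine Finset.sum_congr rfl fun k _ => ?_
  simp only [Bof]; ring

variable {E : Type} [NormedAddCommGroup E] [NormedSpace ℝ E]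

/-- The flux density in the variation of the circulation along the segment from `p + P z` to
`q + Q z`, when `z` moves in the direction `v`. -/
def segmentFlux (A : (Fin d → ℝ) → (Fin d → ℝ)) (P Q : E →L[ℝ] (Fin d → ℝ)) (p q : Fin d → ℝ)
    (v : E) (t : ℝ) (z : E) : ℝ :=
  ∑ j, ∑ k, Bof A j k ((p + t • (q - p)) + (P + t • (Q - P)) z) *
    ((P + t • (Q - P)) v j * ((q - p) k + (ContinuousLinearMap.proj k ∘L (Q - P)) z))

lemma contDiff_segment_integrand {A : (Fin d → ℝ) → (Fin d → ℝ)} (hA : ContDiff ℝ ∞ A)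
    (P Q : E →L[ℝ] (Fin d → ℝ)) (p q : Fin d → ℝ) :
    ContDiff ℝ ∞ fun r : ℝ × E =>
      dotL d (A (p + P r.2 + r.1 • (q + Q r.2 - (p + P r.2)))) (q + Q r.2 - (p + P r.2)) := by
  have h1 : ContDiff ℝ ∞ fun r : ℝ × E => q + Q r.2 - (p + P r.2) := by fun_prop
  have h2 : ContDiff ℝ ∞ fun r : ℝ × E => p + P r.2 + r.1 • (q + Q r.2 - (p + P r.2)) := by
    fun_prop
  exact ((dotL d).contDiff.comp (hA.comp h2)).clm_apply h1

lemma contDiff_segmentFlux {A : (Fin d → ℝ) → (Fin d → ℝ)} (hA : ContDiff ℝ ∞ A)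
    (P Q : E →L[ℝ] (Fin d → ℝ)) (p q : Fin d → ℝ) (v : E) :
    ContDiff ℝ ∞ fun r : ℝ × E => segmentFlux A P Q p q v r.1 r.2 := by
  unfold segmentFlux
  refine ContDiff.sum fun j _ => ContDiff.sum fun k _ => ?_
  have h1 : ContDiff ℝ ∞ fun r : ℝ × E => (p + r.1 • (q - p)) + (P + r.1 • (Q - P)) r.2 := by
    simp only [add_apply, smul_apply]
    fun_prop
  have h2 : ContDiff ℝ ∞ fun r : ℝ × E => (P + r.1 • (Q - P)) v j := by
    simp only [add_apply, smul_apply, Pi.add_apply, Pi.smul_apply]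
    fun_prop
  exact ((contDiff_Bof hA j k).comp h1).mul (h2.mul (by fun_prop))

variable [FiniteDimensional ℝ E]

lemma contDiff_segmentCirculation {A : (Fin d → ℝ) → (Fin d → ℝ)} (hA : ContDiff ℝ ∞ A)
    (P Q : E →L[ℝ] (Fin d → ℝ)) (p q : Fin d → ℝ) :
    ContDiff ℝ ∞ fun z => segmentCirculation A (p + P z) (q + Q z) := by
  simp only [segmentCirculation_eq]
  exact contDiff_infty.2 fun n =>
    (contDiff_setIntegral_nat isCompact_Icc n (contDiff_segment_integrand hA P Q p q)).1

lemma fderiv_segmentCirculation {A : (Fin d → ℝ) → (Fin d → ℝ)} (hA : ContDiff ℝ ∞ A)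
    (P Q : E →L[ℝ] (Fin d → ℝ)) (p q : Fin d → ℝ) (z v : E) :
    fderiv ℝ (fun z => segmentCirculation A (p + P z) (q + Q z)) z v =
      dotR (A (q + Q z)) (Q v) - dotR (A (p + P z)) (P v) +
        ∫ t in Icc (0:ℝ) 1, segmentFlux A P Q p q v t z := by
  have hsm := contDiff_segment_integrand hA P Q p q
  let H : ℝ → E → ℝ := fun t z =>
    dotL d (A (p + P z + t • (q + Q z - (p + P z)))) (q + Q z - (p + P z))
  let y : Fin d → ℝ := q + Q z - (p + P z)
  let ζ : ℝ → Fin d → ℝ := fun t => p + P z + t • y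
  let R : ℝ → E →L[ℝ] (Fin d → ℝ) := fun t => P + t • (Q - P)
  have hA' : ∀ x, HasFDerivAt A (fderiv ℝ A x) x := fun x =>
    (hA.differentiable (by simp) x).hasFDerivAt
  have hH : ∀ t, fderiv ℝ (H t) z v =
      dotL d (A (ζ t)) ((Q - P) v) + dotL d (fderiv ℝ A (ζ t) (R t v)) y := by
    intro t
    have e1 : HasFDerivAt (fun z => q + Q z - (p + P z)) (Q - P) z :=
      (Q.hasFDerivAt.const_add q).sub (P.hasFDerivAt.const_add p)
    have e2 : HasFDerivAt (fun z => p + P z + t • (q + Q z - (p + P z))) (R t) z :=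
      (P.hasFDerivAt.const_add p).add (e1.const_smul t)
    have e3 := (dotL d).hasFDerivAt_of_bilinear ((hA' (ζ t)).comp z e2) e1
    have e4 : fderiv ℝ (H t) z = _ := e3.fderiv
    rw [e4]
    simp [ζ, y]
  let g : ℝ → ℝ := fun t => dotL d (A (ζ t)) (R t v)
  have hζ : ContDiff ℝ ∞ ζ := by fun_prop
  have hR : ContDiff ℝ ∞ fun t => R t v := by
    simp only [R, add_apply, smul_apply]; fun_prop
  have hg : ContDiff ℝ ∞ g := ((dotL d).contDiff.comp (hA.comp hζ)).clm_apply hR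
  have hg' : ∀ t, deriv g t =
      dotL d (A (ζ t)) ((Q - P) v) + dotL d (fderiv ℝ A (ζ t) y) (R t v) := by
    intro t
    have e1 : HasDerivAt ζ y t := by
      have := ((hasDerivAt_id t).smul_const y).const_add (p + P z)
      rw [one_smul] at this
      exact this
    have e2 : HasDerivAt (fun t => R t v) ((Q - P) v) t := by
      simpa [R] using ((hasDerivAt_id t).smul_const ((Q - P) v)).const_add (P v)
    have e3 := (dotL d).hasFDerivAt_of_bilinear
      ((hA' (ζ t)).comp_hasDerivAt t e1).hasFDerivAt e2.hasFDerivAt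
    have e4 := e3.hasDerivAt.deriv
    refine e4.trans ?_
    simp
  have hftc : ∫ t in Icc (0:ℝ) 1, deriv g t =
      dotR (A (q + Q z)) (Q v) - dotR (A (p + P z)) (P v) := by
    rw [integral_Icc_eq_integral_Ioc, ← intervalIntegral.integral_of_le zero_le_one,
      intervalIntegral.integral_deriv_eq_sub (fun t _ => hg.differentiable (by simp) t)
        ((hg.continuous_deriv (by simp)).intervalIntegrable _ _)]
    simp [g, ζ, R, y, dotL_apply]
  have hflux : ∀ t, fderiv ℝ (H t) z v - deriv g t = segmentFlux A P Q p q v t z := by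
    intro t
    rw [hH, hg']
    have := sum_Bof_mul (A := A) (ζ t) (R t v) y
    rw [add_sub_add_left_eq_sub, ← this]
    refine Finset.sum_congr rfl fun j _ => Finset.sum_congr rfl fun k _ => ?_
    congr 2
    · simp only [ζ, y, add_apply, smul_apply, sub_apply]; module
    · simp [y]; ring
  have hD : ContDiff ℝ 0 fun t => fderiv ℝ (H t) z :=
    ContDiff.fderiv (m := ∞) (f := H) hsm contDiff_const (by simp)
  have hc := hD.continuous
  have hc' : Continuous fun t => fderiv ℝ (H t) z v := by fun_prop
  have hint : ∀ {f : ℝ → ℝ}, Continuous f → IntegrableOn f (Icc 0 1) := fun hf =>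
    hf.continuousOn.integrableOn_compact isCompact_Icc
  have hmain := hasFDerivAt_setIntegral_of_contDiff (μ := volume) (H := H)
    (isCompact_Icc (a := (0:ℝ)) (b := 1)) hsm z
  simp only [segmentCirculation_eq]
  rw [hmain.fderiv, ContinuousLinearMap.integral_apply
    (hc.continuousOn.integrableOn_compact isCompact_Icc), ← hftc]
  simp only [← hflux]
  rw [integral_sub (hint hc') (hint (hg.continuous_deriv (by simp)))]
  ring

lemma symbolBound_Bof {A : (Fin d → ℝ) → (Fin d → ℝ)} (hA : ContDiff ℝ ∞ A)
    (hB : BBounded (Bof A)) {ι : Type*} (m : ℕ) (j k : Fin d) :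
    SymbolBound univ m (fun _ : ι => 1) (fun _ => Bof A j k) := by
  refine SymbolBound.of_dList (Pi.basisFun ℝ (Fin d)) (fun _ => zero_le_one) m
    (fun _ => contDiff_Bof hA j k) fun L => ?_
  obtain ⟨C, hC⟩ := hB j k L
  refine ⟨C, fun _ x _ => ?_⟩
  have : (Pi.basisFun ℝ (Fin d) : Fin d → Fin d → ℝ) = fun i => Pi.single i 1 := by
    funext i; simp
  rw [mul_one, this]
  exact hC x

lemma symbolBound_integral_segmentFlux {A : (Fin d → ℝ) → (Fin d → ℝ)} (hA : ContDiff ℝ ∞ A)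
    (hB : BBounded (Bof A)) {ι : Type*} {K : Set E} (hK : IsCompact K) (m : ℕ) {w : ι → ℝ}
    (P Q : E →L[ℝ] (Fin d → ℝ)) (p q : ι → Fin d → ℝ) (hw : ∀ i, 1 + ‖p i - q i‖ ≤ w i) (v : E) :
    SymbolBound K m w
      (fun i z => ∫ t in Icc (0:ℝ) 1, segmentFlux A P Q (p i) (q i) v t z) := by
  have hw1 : ∀ i, 1 ≤ w i := fun i => by linarith [hw i, norm_nonneg (p i - q i)]
  refine SymbolBound.setIntegral isCompact_Icc
    (fun i => contDiff_segmentFlux hA P Q (p i) (q i) v) ?_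
  refine SymbolBound.sum _ (fun r => zero_le_one.trans (hw1 _)) fun j _ =>
    SymbolBound.sum _ (fun r => zero_le_one.trans (hw1 _)) fun k _ => ?_
  have hR : ∀ t ∈ Icc (0:ℝ) 1, ‖P + t • (Q - P)‖ ≤ ‖P‖ + ‖Q - P‖ := by
    intro t ht
    refine (norm_add_le _ _).trans (add_le_add_right ?_ _)
    rw [norm_smul, Real.norm_of_nonneg ht.1]
    exact mul_le_of_le_one_left (norm_nonneg _) ht.2
  have b1 := (symbolBound_Bof (ι := ι × Icc (0:ℝ) 1) hA hB m j k).comp_affine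
    (fun r => P + (r.2 : ℝ) • (Q - P)) (fun r => p r.1 + (r.2 : ℝ) • (q r.1 - p r.1))
    (‖P‖ + ‖Q - P‖) (fun r => hR _ r.2.2) K
  have b2 : SymbolBound K m (fun _ : ι × Icc (0:ℝ) 1 => (‖P‖ + ‖Q - P‖) * ‖v‖)
      (fun r _ => (P + (r.2 : ℝ) • (Q - P)) v j) := by
    refine SymbolBound.const _ fun r => (norm_le_pi_norm _ j).trans ?_
    exact ((P + (r.2 : ℝ) • (Q - P)).le_opNorm v).trans
      (mul_le_mul_of_nonneg_right (hR _ r.2.2) (norm_nonneg _))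
  have b3 : SymbolBound K m (fun r : ι × Icc (0:ℝ) 1 => w r.1)
      (fun r z => (q r.1 - p r.1) k + (ContinuousLinearMap.proj k ∘L (Q - P)) z) := by
    refine SymbolBound.const_add_clm hK _ _ (fun r => (norm_le_pi_norm _ k).trans ?_)
      fun r => hw1 _
    rw [norm_sub_rev]
    linarith [hw r.1]
  obtain ⟨h1, C, hC, h2⟩ := b1.mul (b2.mul b3)
  refine ⟨h1, C * ((‖P‖ + ‖Q - P‖) * ‖v‖), by positivity, fun r z hz n hn =>
    (h2 r z hz n hn).trans (le_of_eq (by ring))⟩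

/-- The circulation of `A` along the broken line from `a` to `b` through `a + z.1`
and `b + z.2`. -/
def brokenCirculation (A : (Fin d → ℝ) → (Fin d → ℝ)) (a b : Fin d → ℝ)
    (z : (Fin d → ℝ) × (Fin d → ℝ)) : ℝ :=
  segmentCirculation A a (a + z.1) + segmentCirculation A (a + z.1) (b + z.2) +
    segmentCirculation A (b + z.2) b

lemma symbolBound_cexp_brokenCirculation {A : (Fin d → ℝ) → (Fin d → ℝ)} (hA : ContDiff ℝ ∞ A)
    (hB : BBounded (Bof A)) {ι : Type*} {K : Set ((Fin d → ℝ) × (Fin d → ℝ))} (hK : IsCompact K)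
    (m : ℕ) (a b : ι → Fin d → ℝ) :
    SymbolBound K m (fun i => (1 + ‖a i - b i‖) ^ m)
      (fun i z => cexp (-I * (brokenCirculation A (a i) (b i) z : ℂ))) := by
  let P1 := ContinuousLinearMap.fst ℝ (Fin d → ℝ) (Fin d → ℝ)
  let P2 := ContinuousLinearMap.snd ℝ (Fin d → ℝ) (Fin d → ℝ)
  have c1 : ∀ i, ContDiff ℝ ∞ fun z => segmentCirculation A (a i) (a i + P1 z) := fun i => by
    simpa using contDiff_segmentCirculation hA 0 P1 (a i) (a i)
  have c2 : ∀ i, ContDiff ℝ ∞ fun z => segmentCirculation A (a i + P1 z) (b i + P2 z) := fun i =>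
    contDiff_segmentCirculation hA P1 P2 (a i) (b i)
  have c3 : ∀ i, ContDiff ℝ ∞ fun z => segmentCirculation A (b i + P2 z) (b i) := fun i => by
    simpa using contDiff_segmentCirculation hA P2 0 (b i) (b i)
  have hψ : ∀ i, ContDiff ℝ ∞ (brokenCirculation A (a i) (b i)) := fun i =>
    ((c1 i).add (c2 i)).add (c3 i)
  have hw1 : ∀ i, 1 ≤ 1 + ‖a i - b i‖ := fun i => by linarith [norm_nonneg (a i - b i)]
  have hder : ∀ i z v, fderiv ℝ (brokenCirculation A (a i) (b i)) z v =
      (∫ t in Icc (0:ℝ) 1, segmentFlux A 0 P1 (a i) (a i) v t z) +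
      (∫ t in Icc (0:ℝ) 1, segmentFlux A P1 P2 (a i) (b i) v t z) +
      (∫ t in Icc (0:ℝ) 1, segmentFlux A P2 0 (b i) (b i) v t z) := by
    intro i z v
    have e1 := fderiv_segmentCirculation hA 0 P1 (a i) (a i) z v
    have e2 := fderiv_segmentCirculation hA P1 P2 (a i) (b i) z v
    have e3 := fderiv_segmentCirculation hA P2 0 (b i) (b i) z v
    simp only [zero_apply, add_zero] at e1 e3
    have hd := fun {f : (Fin d → ℝ) × (Fin d → ℝ) → ℝ} (hf : ContDiff ℝ ∞ f) =>
      (hf.differentiable (by simp) z).hasFDerivAt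
    have := (((hd (c1 i)).add (hd (c2 i))).add (hd (c3 i))).fderiv
    have h4 : fderiv ℝ (brokenCirculation A (a i) (b i)) z = _ := this
    rw [h4, add_apply, add_apply, e1, e2, e3]
    simp only [dotR, Pi.zero_apply, mul_zero, Finset.sum_const_zero]
    ring
  refine SymbolBound.cexp_neg_I_mul hψ hw1 ?_
  have hfd : SymbolBound K m (fun i => 1 + ‖a i - b i‖)
      (fun i => fderiv ℝ (brokenCirculation A (a i) (b i))) := by
    refine SymbolBound.fderiv_of_basis
      (Module.finBasis ℝ ((Fin d → ℝ) × (Fin d → ℝ))) (fun i => zero_le_one.trans (hw1 i))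
      fun k => ?_
    simp only [hder]
    refine ((symbolBound_integral_segmentFlux hA hB hK m 0 P1 a a (fun i => ?_) _).add
      (symbolBound_integral_segmentFlux hA hB hK m P1 P2 a b (fun i => le_rfl) _)).add
      (symbolBound_integral_segmentFlux hA hB hK m P2 0 b b (fun i => ?_) _)
    all_goals simp
  obtain ⟨-, C, hC, h⟩ := hfd
  refine ⟨C, fun i z hz n h1 hn => ?_⟩
  obtain ⟨n, rfl⟩ : ∃ k, n = k + 1 := ⟨n - 1, by omega⟩
  rw [← norm_iteratedFDeriv_fderiv]
  exact h i z hz n (by omega)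

end Phase

section Symbols

open Set

variable {d : ℕ}

lemma HormClass.fderiv_dirXi {p : ℝ} {Φ : (Fin d → ℝ) × (Fin d → ℝ) → ℂ} (h : HormClass d p Φ)
    (j : Fin d) : HormClass d p (fun q => fderiv ℝ Φ q (dirXi j)) := by
  refine ⟨(h.1.fderiv_right (m := ∞) (by simp)).clm_apply contDiff_const, fun a b => ?_⟩
  obtain ⟨C, hC⟩ := h.2 a (b ++ [j])
  refine ⟨C, fun x ξ => ?_⟩
  rw [dList_fderiv]
  simpa using hC x ξ

lemma dList_map_dirX {Φ : (Fin d → ℝ) × (Fin d → ℝ) → ℂ} (hΦ : ContDiff ℝ ∞ Φ)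
    (a : List (Fin d)) : ContDiff ℝ ∞ (dList (a.map dirX) Φ) ∧ ∀ x ξ,
      dList (a.map dirX) Φ (x, ξ) =
        dList (a.map fun j => Pi.single j (1 : ℝ)) (fun x => Φ (x, ξ)) x := by
  induction a with
  | nil => exact ⟨hΦ, fun x ξ => rfl⟩
  | cons j a ih =>
    refine ⟨(ih.1.fderiv_right (m := ∞) (by simp)).clm_apply contDiff_const, fun x ξ => ?_⟩
    have h1 : (dList (a.map fun j => Pi.single j (1 : ℝ)) fun x => Φ (x, ξ)) =
        fun x => dList (a.map dirX) Φ (x, ξ) := funext fun x => (ih.2 x ξ).symm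
    have h2 := (HasFDerivAt.comp (f := fun e => (e, ξ)) x
      (ih.1.differentiable (by simp) (x, ξ)).hasFDerivAt
      (hasFDerivAt_prodMk_left (𝕜 := ℝ) x ξ)).fderiv
    have h3 : fderiv ℝ (fun x => dList (a.map dirX) Φ (x, ξ)) x = _ := h2
    simp only [List.map_cons, dList, h1, h3]
    simp [dirX]

lemma HormClass.symbolBound {p : ℝ} {Φ : (Fin d → ℝ) × (Fin d → ℝ) → ℂ} (h : HormClass d p Φ)
    (m : ℕ) : SymbolBound univ m (fun η : Fin d → ℝ => jap η ^ p) (fun η x => Φ (x, η)) := by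
  refine SymbolBound.of_dList (Pi.basisFun ℝ (Fin d))
    (fun η => Real.rpow_nonneg (Real.sqrt_nonneg _) _) m
    (fun η => h.1.comp (contDiff_prodMk_left η)) fun L => ?_
  obtain ⟨C, hC⟩ := h.2 L []
  refine ⟨C, fun η x _ => ?_⟩
  have h1 := hC x η
  rw [List.map_nil, List.append_nil, (dList_map_dirX h.1 L).2] at h1
  have h2 : (⇑(Pi.basisFun ℝ (Fin d)) : Fin d → Fin d → ℝ) = fun j => Pi.single j 1 :=
    funext fun j => Pi.basisFun_apply ℝ (Fin d) j
  rwa [h2]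

/-- The midpoint map `(u, v) ↦ (u + v) / 2`. -/
def midL (d : ℕ) : (Fin d → ℝ) × (Fin d → ℝ) →L[ℝ] Fin d → ℝ :=
  (2 : ℝ)⁻¹ • (ContinuousLinearMap.fst ℝ _ _ + ContinuousLinearMap.snd ℝ _ _)

lemma midL_apply (z : (Fin d → ℝ) × (Fin d → ℝ)) : midL d z = (2 : ℝ)⁻¹ • (z.1 + z.2) := rfl

lemma HormClass.symbolBound_midL {p : ℝ} {Φ : (Fin d → ℝ) × (Fin d → ℝ) → ℂ}
    (h : HormClass d p Φ) {ι : Type*} (c : ι → Fin d → ℝ) (m : ℕ)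
    (K : Set ((Fin d → ℝ) × (Fin d → ℝ))) :
    SymbolBound K m (fun q : ι × (Fin d → ℝ) => jap q.2 ^ p)
      (fun q z => Φ (c q.1 + midL d z, q.2)) :=
  ((h.symbolBound m).reindex (fun q : ι × (Fin d → ℝ) => q.2)).comp_affine
    (fun _ => midL d) (fun q => c q.1) ‖midL d‖ (fun _ => le_rfl) K

end Symbols

section Oscillation

open Set

/-- Decay of an oscillatory integral with linear phase and compactly supported amplitude. -/
lemma pow_mul_norm_integral_cexp_le {E : Type*} [NormedAddCommGroup E] [NormedSpace ℝ E]
    [FiniteDimensional ℝ E] [MeasurableSpace E] [BorelSpace E] (μ : Measure E)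
    [μ.IsAddHaarMeasure] {K : Set E} (hK : IsCompact K) {f : E → ℂ} (hf : ContDiff ℝ ∞ f)
    (hs : tsupport f ⊆ K) (κ : E →L[ℝ] ℝ) (v : E) (n : ℕ) {C : ℝ}
    (hC : ∀ z ∈ K, ∀ k ≤ n, ‖iteratedFDeriv ℝ k f z‖ ≤ C) :
    |κ v| ^ n * ‖∫ z, cexp (I * (κ z : ℂ)) * f z ∂μ‖ ≤
      (2 * Real.pi * ‖v‖) ^ n * (2 ^ n * ((n + 1) * (C * μ.real K))) := by
  have hpi := Real.pi_pos
  let L : E →L[ℝ] (E →L[ℝ] ℝ) →L[ℝ] ℝ := (ContinuousLinearMap.id ℝ (E →L[ℝ] ℝ)).flip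
  let w : E →L[ℝ] ℝ := -(1 / (2 * Real.pi)) • κ
  have hsupp : ∀ k : ℕ, ∀ z ∉ K, iteratedFDeriv ℝ k f z = 0 := fun k z hz => by
    by_contra h
    exact hz (hs (support_iteratedFDeriv_subset k h))
  have hcs : HasCompactSupport f := hK.of_isClosed_subset (isClosed_tsupport f) hs
  have hint : ∀ k n : ℕ, Integrable (fun v => ‖v‖ ^ k * ‖iteratedFDeriv ℝ n f v‖) μ := by
    intro k n
    refine Continuous.integrable_of_hasCompactSupport
      ((continuous_norm.pow k).mul (hf.continuous_iteratedFDeriv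
        (m := n) (by exact_mod_cast le_top)).norm) ?_
    exact ((hcs.iteratedFDeriv n).norm).mul_left
  have key := VectorFourier.pow_mul_norm_iteratedFDeriv_fourierIntegral_le (μ := μ) L
    (K := 0) (N := ⊤) (f := f) (hf.of_le le_rfl) (fun k n _ _ => hint k n) (k := 0) (n := n)
    le_rfl le_top v w
  have hF : VectorFourier.fourierIntegral Real.fourierChar μ L.toLinearMap₁₂ f w =
      ∫ z, cexp (I * (κ z : ℂ)) * f z ∂μ := by
    unfold VectorFourier.fourierIntegral
    congr 1
    ext z
    rw [Circle.smul_def, Real.fourierChar_apply, smul_eq_mul]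
    congr 2
    have : (L.toLinearMap₁₂ z) w = -(1 / (2 * Real.pi)) * κ z := rfl
    rw [this]
    push_cast
    field_simp
  have hLv : L v w = -(1 / (2 * Real.pi)) * κ v := rfl
  rw [norm_iteratedFDeriv_zero, hF, hLv] at key
  have hsum : ∑ p ∈ Finset.range (0 + 1) ×ˢ Finset.range (n + 1),
      ∫ v, ‖v‖ ^ p.1 * ‖iteratedFDeriv ℝ p.2 f v‖ ∂μ ≤ (n + 1) * (C * μ.real K) := by
    have : ∀ p ∈ Finset.range (0 + 1) ×ˢ Finset.range (n + 1),
        ∫ v, ‖v‖ ^ p.1 * ‖iteratedFDeriv ℝ p.2 f v‖ ∂μ ≤ C * μ.real K := by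
      intro p hp
      simp only [Finset.mem_product, Finset.mem_range] at hp
      have hp1 : p.1 = 0 := by omega
      simp only [hp1, pow_zero, one_mul]
      rw [← setIntegral_eq_integral_of_forall_compl_eq_zero (s := K)
        (fun z hz => by rw [hsupp _ z hz, norm_zero])]
      refine (Real.le_norm_self _).trans (norm_setIntegral_le_of_norm_le_const
        hK.measure_lt_top fun z hz => ?_)
      rw [norm_norm]
      exact hC z hz _ (by omega)
    refine (Finset.sum_le_card_nsmul _ _ _ this).trans (le_of_eq ?_)
    simp
  have e1 : |κ v| ^ n = (2 * Real.pi) ^ n * |-(1 / (2 * Real.pi)) * κ v| ^ n := by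
    rw [← mul_pow, abs_mul, abs_neg, abs_of_pos (by positivity : 0 < 1 / (2 * Real.pi))]
    congr 1
    field_simp
  rw [e1, mul_assoc, mul_pow _ ‖v‖, mul_assoc]
  refine mul_le_mul_of_nonneg_left (key.trans ?_) (by positivity)
  simp only [pow_zero, mul_one, Nat.cast_zero, mul_zero, zero_add]
  rw [mul_assoc]
  gcongr

end Oscillation

section GaborIntegral

open Set

variable {d : ℕ}

lemma exists_norm_eq_abs_apply [Nonempty (Fin d)] (x : Fin d → ℝ) : ∃ j, ‖x‖ = |x j| := by
  obtain ⟨j, hj⟩ := Finite.exists_max fun i => ‖x i‖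
  exact ⟨j, le_antisymm ((pi_norm_le_iff_of_nonneg (norm_nonneg _)).2 hj) (norm_le_pi_norm x j)⟩

lemma one_add_add_pow_le {a b : ℝ} (ha : 0 ≤ a) (hb : 0 ≤ b) (m : ℕ) :
    (1 + a + b) ^ m ≤ 3 ^ m * (1 + a ^ m + b ^ m) := by
  have h : ∀ c, 0 ≤ c → 1 ≤ c → a ≤ c → b ≤ c → c ^ m ≤ 1 + a ^ m + b ^ m →
      (1 + a + b) ^ m ≤ 3 ^ m * (1 + a ^ m + b ^ m) := by
    intro c hc h1 h2 h3 h4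
    calc (1 + a + b) ^ m ≤ (3 * c) ^ m := pow_le_pow_left₀ (by positivity) (by linarith) _
      _ = 3 ^ m * c ^ m := mul_pow _ _ _
      _ ≤ _ := by gcongr
  have ham := pow_nonneg ha m
  have hbm := pow_nonneg hb m
  rcases le_total a b with hab | hab
  · rcases le_total b 1 with h1 | h1
    · exact h 1 zero_le_one le_rfl (hab.trans h1) h1 (by rw [one_pow]; linarith)
    · exact h b hb h1 hab le_rfl (by linarith)
  · rcases le_total a 1 with h1 | h1
    · exact h 1 zero_le_one le_rfl h1 (hab.trans h1) (by rw [one_pow]; linarith)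
    · exact h a ha h1 le_rfl hab (by linarith)

lemma isAddHaarMeasure_volume_prod (d : ℕ) :
    (volume : Measure ((Fin d → ℝ) × (Fin d → ℝ))).IsAddHaarMeasure :=
  Measure.prod.instIsAddHaarMeasure volume volume

/-- The linear phase `(u, v) ↦ ⟨ζ, u⟩ - ⟨ζ', v⟩`. -/
def phaseL (ζ ζ' : Fin d → ℝ) : (Fin d → ℝ) × (Fin d → ℝ) →L[ℝ] ℝ :=
  (dotL d ζ).comp (ContinuousLinearMap.fst ℝ _ _) - (dotL d ζ').comp (ContinuousLinearMap.snd ℝ _ _)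

lemma phaseL_apply (ζ ζ' : Fin d → ℝ) (z : (Fin d → ℝ) × (Fin d → ℝ)) :
    phaseL ζ ζ' z = dotR ζ z.1 - dotR ζ' z.2 := by
  simp [phaseL, dotL_apply]

/-- The position integral of a Gabor matrix element with amplitude `F` and symbol `Φ`, centred at
lattice points with difference `δ` and midpoint `c`, and frequencies `k`, `k'`. -/
def gaborIntegral (F Φ : (Fin d → ℝ) × (Fin d → ℝ) → ℂ) (δ c k k' η : Fin d → ℝ) : ℂ :=
  ∫ z : (Fin d → ℝ) × (Fin d → ℝ),
    cexp (I * ((dotR η δ + phaseL (η - k) (η - k') z : ℝ) : ℂ)) * (F z * Φ (c + midL d z, η))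

lemma gaborIntegral_eq (F Φ : (Fin d → ℝ) × (Fin d → ℝ) → ℂ) (δ c k k' η : Fin d → ℝ) :
    gaborIntegral F Φ δ c k k' η = cexp (I * (dotR η δ : ℂ)) *
      ∫ z, cexp (I * (phaseL (η - k) (η - k') z : ℂ)) * (F z * Φ (c + midL d z, η)) := by
  rw [gaborIntegral, ← integral_const_mul]
  congr 1
  ext z
  rw [ofReal_add, mul_add, Complex.exp_add, mul_assoc]

lemma norm_gaborIntegral_le [Nonempty (Fin d)] {ι : Type*}
    {K : Set ((Fin d → ℝ) × (Fin d → ℝ))} (hK : IsCompact K) {m : ℕ} {W : ι → ℝ}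
    {F : ι → (Fin d → ℝ) × (Fin d → ℝ) → ℂ} (hF : SymbolBound K m W F) (hW : ∀ i, 0 ≤ W i)
    (hs : ∀ i, tsupport (F i) ⊆ K) {p : ℝ} {Φ : (Fin d → ℝ) × (Fin d → ℝ) → ℂ}
    (hΦ : HormClass d p Φ) :
    ∃ C, 0 ≤ C ∧ ∀ i δ c k k' η, (1 + ‖η - k‖ + ‖η - k'‖) ^ m *
      ‖gaborIntegral (F i) Φ δ c k k' η‖ ≤ C * (W i * jap η ^ p) := by
  have := isAddHaarMeasure_volume_prod d
  obtain ⟨hsm, C, hC, hb⟩ := (hF.reindex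
    (fun q : (ι × (Fin d → ℝ)) × (Fin d → ℝ) => q.1.1)).mul
    (hΦ.symbolBound_midL (fun q : ι × (Fin d → ℝ) => q.2) m K)
  set S : ℝ := (2 * Real.pi * 1) ^ m * (2 ^ m * ((m + 1) * (C * volume.real K)))
  set S0 : ℝ := C * volume.real K
  have hS : 0 ≤ S := by positivity
  have hS0 : 0 ≤ S0 := by positivity
  refine ⟨3 ^ m * (S0 + S + S), by positivity, fun i δ c k k' η => ?_⟩
  set w := W i * jap η ^ p
  have hw : 0 ≤ w := mul_nonneg (hW i) (Real.rpow_nonneg (Real.sqrt_nonneg _) _)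
  have hnorm : ‖gaborIntegral (F i) Φ δ c k k' η‖ =
      ‖∫ z, cexp (I * (phaseL (η - k) (η - k') z : ℂ)) * (F i z * Φ (c + midL d z, η))‖ := by
    rw [gaborIntegral_eq, norm_mul, mul_comm I, norm_exp_ofReal_mul_I, one_mul]
  rw [hnorm]
  set T := ‖∫ z, cexp (I * (phaseL (η - k) (η - k') z : ℂ)) * (F i z * Φ (c + midL d z, η))‖
  have hts : tsupport (fun z => F i z * Φ (c + midL d z, η)) ⊆ K :=
    (tsupport_mul_subset_left).trans (hs i)
  have h0 : T ≤ S0 * w := by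
    have := pow_mul_norm_integral_cexp_le volume hK (hsm ((i, c), η)) hts
      (phaseL (η - k) (η - k')) 0 0 (C := C * w)
      (fun z hz n hn => hb ((i, c), η) z hz n (by omega))
    simp only [pow_zero, one_mul, Nat.cast_zero, zero_add] at this
    linarith
  have hm : ∀ v, ‖v‖ ≤ 1 → |phaseL (η - k) (η - k') v| ^ m * T ≤ S * w := by
    intro v hv
    refine (pow_mul_norm_integral_cexp_le volume hK (hsm ((i, c), η)) hts
      (phaseL (η - k) (η - k')) v m (C := C * w) (hb ((i, c), η))).trans ?_
    have : (2 * Real.pi * ‖v‖) ^ m ≤ (2 * Real.pi * 1) ^ m := by gcongr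
    calc _ ≤ (2 * Real.pi * 1) ^ m * (2 ^ m * ((m + 1) * (C * w * volume.real K))) := by
          gcongr
      _ = S * w := by simp only [S]; ring
  have h1 : ‖η - k‖ ^ m * T ≤ S * w := by
    obtain ⟨j, hj⟩ := exists_norm_eq_abs_apply (η - k)
    have := hm (Pi.single j 1, 0) (by simp [Prod.norm_def, Pi.norm_single])
    rwa [phaseL_apply, show dotR (η - k) (Pi.single j 1, (0 : Fin d → ℝ)).1 -
      dotR (η - k') (Pi.single j 1, (0 : Fin d → ℝ)).2 = (η - k) j by
        simp [dotR, Pi.single_apply], ← hj] at this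
  have h2 : ‖η - k'‖ ^ m * T ≤ S * w := by
    obtain ⟨j, hj⟩ := exists_norm_eq_abs_apply (η - k')
    have := hm (0, Pi.single j 1) (by simp [Prod.norm_def, Pi.norm_single])
    rwa [phaseL_apply, show dotR (η - k) ((0 : Fin d → ℝ), (Pi.single j 1 : Fin d → ℝ)).1 -
      dotR (η - k') ((0 : Fin d → ℝ), (Pi.single j 1 : Fin d → ℝ)).2 = -(η - k') j by
        simp [dotR, Pi.single_apply], abs_neg, ← hj] at this
  calc _ ≤ 3 ^ m * (1 + ‖η - k‖ ^ m + ‖η - k'‖ ^ m) * T :=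
        mul_le_mul_of_nonneg_right
          (one_add_add_pow_le (norm_nonneg _) (norm_nonneg _) m) (norm_nonneg _)
    _ = 3 ^ m * (T + ‖η - k‖ ^ m * T + ‖η - k'‖ ^ m * T) := by ring
    _ ≤ 3 ^ m * (S0 * w + S * w + S * w) := by gcongr
    _ = _ := by ring

end GaborIntegral

section Integrability

open Set

variable {d : ℕ}

lemma rpow_le_of_comparable {a b c : ℝ} (ha : 0 < a) (hb : 0 < b) (hc : 0 < c) (h1 : a ≤ c * b)
    (h2 : b ≤ c * a) (p : ℝ) : a ^ p ≤ c ^ |p| * b ^ p := by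
  rcases le_or_gt 0 p with hp | hp
  · rw [abs_of_nonneg hp, ← Real.mul_rpow hc.le hb.le]
    exact Real.rpow_le_rpow ha.le h1 hp
  · have h3 : b / c ≤ a := by rwa [div_le_iff₀' hc]
    calc a ^ p ≤ (b / c) ^ p := Real.rpow_le_rpow_of_nonpos (by positivity) h3 hp.le
      _ = c ^ |p| * b ^ p := by
        rw [abs_of_neg hp, Real.div_rpow hb.le hc.le, Real.rpow_neg hc.le]
        field_simp

lemma dotR_self_nonneg (x : Fin d → ℝ) : 0 ≤ dotR x x :=
  Finset.sum_nonneg fun i _ => mul_self_nonneg (x i)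

lemma jap_pos (x : Fin d → ℝ) : 0 < jap x :=
  Real.sqrt_pos.2 (by linarith [dotR_self_nonneg x])

lemma one_add_norm_le_jap (x : Fin d → ℝ) : 1 + ‖x‖ ≤ (2 + d) * jap x := by
  have h1 : 1 ≤ jap x := Real.one_le_sqrt.2 (by linarith [dotR_self_nonneg x])
  have h2 : ‖x‖ ≤ jap x := by
    refine (pi_norm_le_iff_of_nonneg (jap_pos x).le).2 fun i => Real.le_sqrt_of_sq_le ?_
    have : x i * x i ≤ dotR x x :=
      Finset.single_le_sum (f := fun i => x i * x i) (fun i _ => mul_self_nonneg (x i))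
        (Finset.mem_univ i)
    rw [Real.norm_eq_abs, sq_abs]
    nlinarith
  have h3 : (0 : ℝ) ≤ d * jap x := by positivity
  linarith

lemma jap_le_one_add_norm (x : Fin d → ℝ) : jap x ≤ (2 + d) * (1 + ‖x‖) := by
  have h1 : dotR x x ≤ d * ‖x‖ ^ 2 := by
    refine (Finset.sum_le_card_nsmul _ _ (‖x‖ ^ 2) fun i _ => ?_).trans (by simp)
    rw [← sq, ← sq_abs]
    exact pow_le_pow_left₀ (abs_nonneg _) (norm_le_pi_norm x i) 2
  refine Real.sqrt_le_iff.2 ⟨by positivity, ?_⟩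
  have h2 := norm_nonneg x
  have h3 : (0 : ℝ) ≤ d := Nat.cast_nonneg d
  have h4 : 0 ≤ (d : ℝ) * ‖x‖ := by positivity
  have h5 : 0 ≤ (d : ℝ) ^ 2 * (1 + ‖x‖) ^ 2 := by positivity
  have h6 : 0 ≤ (d : ℝ) * ‖x‖ ^ 2 := by positivity
  nlinarith

lemma jap_rpow_le (η k k' : Fin d → ℝ) (p : ℝ) :
    jap η ^ p ≤ ((2 + d) * 2) ^ |p| * (1 + ‖η - k‖ + ‖η - k'‖) ^ |p| * (1 + ‖k + k'‖) ^ p := by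
  have h1 : 2 * ‖η‖ ≤ ‖η - k‖ + ‖η - k'‖ + ‖k + k'‖ := by
    calc 2 * ‖η‖ = ‖(2 : ℝ) • η‖ := by simp [norm_smul]
      _ = ‖(η - k) + (η - k') + (k + k')‖ := by
        congr 1
        rw [two_smul]
        abel
      _ ≤ _ := norm_add₃_le
  have h2 : ‖k + k'‖ ≤ ‖η - k‖ + ‖η - k'‖ + 2 * ‖η‖ := by
    calc ‖k + k'‖ = ‖-(η - k) + -(η - k') + (2 : ℝ) • η‖ := by
          congr 1
          rw [two_smul]
          abel
      _ ≤ ‖-(η - k)‖ + ‖-(η - k')‖ + ‖(2 : ℝ) • η‖ := norm_add₃_le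
      _ = _ := by simp only [norm_neg, norm_smul, Real.norm_eq_abs, abs_two]
  set D := 1 + ‖η - k‖ + ‖η - k'‖
  have hD : 1 ≤ D := by
    have := norm_nonneg (η - k)
    have := norm_nonneg (η - k')
    simp only [D]
    linarith
  have hη := norm_nonneg η
  have hs := norm_nonneg (k + k')
  have hd : (0 : ℝ) ≤ d := Nat.cast_nonneg d
  rw [← Real.mul_rpow (by positivity) (by positivity)]
  refine rpow_le_of_comparable (jap_pos η) (by positivity) (by positivity) ?_ ?_ p
  · calc jap η ≤ (2 + d) * (1 + ‖η‖) := jap_le_one_add_norm η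
      _ ≤ (2 + d) * (2 * D * (1 + ‖k + k'‖)) := by
        gcongr
        nlinarith
      _ = _ := by ring
  · calc 1 + ‖k + k'‖ ≤ 2 * D * (1 + ‖η‖) := by nlinarith
      _ ≤ 2 * D * ((2 + d) * jap η) := by
        gcongr
        exact one_add_norm_le_jap η
      _ = _ := by ring

lemma norm_gaborIntegral_le_rpow [Nonempty (Fin d)] {ι : Type*}
    {K : Set ((Fin d → ℝ) × (Fin d → ℝ))} (hK : IsCompact K) {m : ℕ} {W : ι → ℝ}
    {F : ι → (Fin d → ℝ) × (Fin d → ℝ) → ℂ} (hF : SymbolBound K m W F) (hW : ∀ i, 0 ≤ W i)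
    (hs : ∀ i, tsupport (F i) ⊆ K) {p : ℝ} {Φ : (Fin d → ℝ) × (Fin d → ℝ) → ℂ}
    (hΦ : HormClass d p Φ) {n : ℕ} (hm : n + ⌈|p|⌉₊ + (d + 1) ≤ m) :
    ∃ C, 0 ≤ C ∧ ∀ i δ c k k' η, (1 + ‖k - k'‖) ^ n * ‖gaborIntegral (F i) Φ δ c k k' η‖ ≤
      C * (W i * (1 + ‖k + k'‖) ^ p) * (1 + ‖η - k‖) ^ (-((d : ℝ) + 1)) := by
  obtain ⟨C, hC, h⟩ := norm_gaborIntegral_le hK hF hW hs hΦ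
  refine ⟨C * ((2 + d) * 2) ^ |p|, by positivity, fun i δ c k k' η => ?_⟩
  have h1 := h i δ c k k' η
  have h2 := jap_rpow_le η k k' p
  set T := ‖gaborIntegral (F i) Φ δ c k k' η‖
  have hT : 0 ≤ T := norm_nonneg _
  set D := 1 + ‖η - k‖ + ‖η - k'‖ with hDdef
  have hk := norm_nonneg (η - k)
  have hk' := norm_nonneg (η - k')
  have hD : 1 ≤ D := by linarith
  have hD1 : 1 + ‖k - k'‖ ≤ D := by
    have : ‖k - k'‖ ≤ ‖η - k‖ + ‖η - k'‖ := by
      calc ‖k - k'‖ = ‖(η - k') - (η - k)‖ := by congr 1; abel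
        _ ≤ _ := norm_sub_le _ _
        _ = _ := add_comm _ _
    linarith
  have hD2 : 1 + ‖η - k‖ ≤ D := by linarith
  set s := (1 + ‖k + k'‖) ^ p
  have hs0 : 0 ≤ s := by positivity
  set P := ⌈|p|⌉₊
  have hP : D ^ |p| ≤ D ^ P := by
    rw [← Real.rpow_natCast]
    exact Real.rpow_le_rpow_of_exponent_le hD (Nat.le_ceil _)
  set M := ((2 + (d : ℝ)) * 2) ^ |p|
  have hM : 0 ≤ M := by positivity
  have h3 : D ^ (n + P + (d + 1)) * T ≤ C * (W i * (M * D ^ P * s)) := by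
    calc _ ≤ D ^ m * T := mul_le_mul_of_nonneg_right (pow_le_pow_right₀ hD hm) hT
      _ ≤ C * (W i * jap η ^ p) := h1
      _ ≤ C * (W i * (M * D ^ |p| * s)) := by
        gcongr
        exact hW i
      _ ≤ _ := by
        gcongr
        exact hW i
  have h4 : D ^ (n + (d + 1)) * T ≤ C * M * (W i * s) := by
    have : 0 < D ^ P := by positivity
    refine le_of_mul_le_mul_left ?_ this
    calc D ^ P * (D ^ (n + (d + 1)) * T) = D ^ (n + P + (d + 1)) * T := by ring
      _ ≤ _ := h3
      _ = _ := by ring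
  have e : (1 + ‖η - k‖) ^ (-((d : ℝ) + 1)) = ((1 + ‖η - k‖) ^ (d + 1))⁻¹ := by
    rw [Real.rpow_neg (by positivity), ← Nat.cast_add_one, Real.rpow_natCast]
  rw [e, ← div_eq_mul_inv, le_div_iff₀ (by positivity)]
  calc _ = (1 + ‖k - k'‖) ^ n * (1 + ‖η - k‖) ^ (d + 1) * T := by ring
    _ ≤ D ^ n * D ^ (d + 1) * T := by gcongr
    _ = D ^ (n + (d + 1)) * T := by ring
    _ ≤ _ := h4

lemma continuous_dotR_s4 : Continuous fun q : (Fin d → ℝ) × (Fin d → ℝ) => dotR q.1 q.2 := by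
  unfold dotR
  fun_prop

lemma aestronglyMeasurable_gaborIntegral {F Φ : (Fin d → ℝ) × (Fin d → ℝ) → ℂ}
    (hF : Continuous F) (hΦ : Continuous Φ) (δ c k k' : Fin d → ℝ) :
    AEStronglyMeasurable (gaborIntegral F Φ δ c k k') := by
  refine (StronglyMeasurable.integral_prod_right (f := fun η z =>
    cexp (I * ((dotR η δ + phaseL (η - k) (η - k') z : ℝ) : ℂ)) * (F z * Φ (c + midL d z, η)))
    (Continuous.stronglyMeasurable ?_)).aestronglyMeasurable
  simp only [phaseL_apply]
  have h1 : ∀ {f g : (Fin d → ℝ) × (Fin d → ℝ) × (Fin d → ℝ) → Fin d → ℝ}, Continuous f →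
      Continuous g → Continuous fun q => dotR (f q) (g q) :=
    fun hf hg => continuous_dotR_s4.comp (hf.prodMk hg)
  have h2 : Continuous fun q : (Fin d → ℝ) × (Fin d → ℝ) × (Fin d → ℝ) =>
      dotR q.1 δ + (dotR (q.1 - k) q.2.1 - dotR (q.1 - k') q.2.2) :=
    (h1 (by fun_prop) (by fun_prop)).add
      ((h1 (by fun_prop) (by fun_prop)).sub (h1 (by fun_prop) (by fun_prop)))
  exact (continuous_const.mul (continuous_ofReal.comp h2)).cexp.mul
    ((hF.comp continuous_snd).mul (hΦ.comp (by fun_prop)))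

lemma norm_integral_gaborIntegral_le [Nonempty (Fin d)] {ι : Type*}
    {K : Set ((Fin d → ℝ) × (Fin d → ℝ))} (hK : IsCompact K) {m : ℕ} {W : ι → ℝ}
    {F : ι → (Fin d → ℝ) × (Fin d → ℝ) → ℂ} (hF : SymbolBound K m W F) (hW : ∀ i, 0 ≤ W i)
    (hs : ∀ i, tsupport (F i) ⊆ K) {p : ℝ} {Φ : (Fin d → ℝ) × (Fin d → ℝ) → ℂ}
    (hΦ : HormClass d p Φ) {n : ℕ} (hm : n + ⌈|p|⌉₊ + (d + 1) ≤ m) :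
    ∃ C, 0 ≤ C ∧ ∀ i δ c k k', Integrable (gaborIntegral (F i) Φ δ c k k') ∧
      (1 + ‖k - k'‖) ^ n * ‖∫ η, gaborIntegral (F i) Φ δ c k k' η‖ ≤
        C * (W i * (1 + ‖k + k'‖) ^ p) := by
  obtain ⟨C, hC, h⟩ := norm_gaborIntegral_le_rpow hK hF hW hs hΦ hm
  have hint : Integrable fun η : Fin d → ℝ => (1 + ‖η‖) ^ (-((d : ℝ) + 1)) :=
    integrable_one_add_norm (by simp)
  refine ⟨C * ∫ η : Fin d → ℝ, (1 + ‖η‖) ^ (-((d : ℝ) + 1)),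
    mul_nonneg hC (integral_nonneg fun η => by positivity), fun i δ c k k' => ?_⟩
  have hq : 0 < (1 + ‖k - k'‖) ^ n := by positivity
  have hi : Integrable fun η => C * (W i * (1 + ‖k + k'‖) ^ p) / (1 + ‖k - k'‖) ^ n *
      (1 + ‖η - k‖) ^ (-((d : ℝ) + 1)) := (hint.comp_sub_right k).const_mul _
  have hb : ∀ η, ‖gaborIntegral (F i) Φ δ c k k' η‖ ≤
      C * (W i * (1 + ‖k + k'‖) ^ p) / (1 + ‖k - k'‖) ^ n *
      (1 + ‖η - k‖) ^ (-((d : ℝ) + 1)) := fun η => by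
    rw [div_mul_eq_mul_div, le_div_iff₀' hq]
    exact h i δ c k k' η
  refine ⟨hi.mono' (aestronglyMeasurable_gaborIntegral (hF.1 i).continuous hΦ.1.continuous _ _ _ _)
    (ae_of_all _ hb), ?_⟩
  have h1 := norm_integral_le_of_norm_le hi (ae_of_all _ hb)
  rw [integral_const_mul, integral_sub_right_eq_self
    (fun η : Fin d → ℝ => (1 + ‖η‖) ^ (-((d : ℝ) + 1)))] at h1
  rw [div_mul_eq_mul_div, le_div_iff₀' hq] at h1
  exact h1.trans (le_of_eq (by ring))

end Integrability

section IntegrationByParts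

open Set

variable {d : ℕ}

lemma contDiff_gaborIntegrand {F Φ : (Fin d → ℝ) × (Fin d → ℝ) → ℂ} (hF : ContDiff ℝ ∞ F)
    (hΦ : ContDiff ℝ ∞ Φ) (δ c k k' : Fin d → ℝ) :
    ContDiff ℝ ∞ fun q : ((Fin d → ℝ) × (Fin d → ℝ)) × (Fin d → ℝ) =>
      cexp (I * ((dotR q.2 δ + phaseL (q.2 - k) (q.2 - k') q.1 : ℝ) : ℂ)) *
        (F q.1 * Φ (c + midL d q.1, q.2)) := by
  simp only [phaseL_apply, ← dotL_apply]
  have h1 : ContDiff ℝ ∞ fun q : ((Fin d → ℝ) × (Fin d → ℝ)) × (Fin d → ℝ) =>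
      dotL d q.2 δ + (dotL d (q.2 - k) q.1.1 - dotL d (q.2 - k') q.1.2) := by
    fun_prop
  exact (contDiff_const.mul (ofRealCLM.contDiff.comp h1)).cexp.mul
    ((hF.comp contDiff_fst).mul (hΦ.comp (by fun_prop)))

lemma fderiv_gaborIntegrand {F Φ : (Fin d → ℝ) × (Fin d → ℝ) → ℂ}
    (hΦ : ContDiff ℝ ∞ Φ) (δ c k k' : Fin d → ℝ) (j : Fin d) (z : (Fin d → ℝ) × (Fin d → ℝ))
    (η : Fin d → ℝ) :
    fderiv ℝ (fun η => cexp (I * ((dotR η δ + phaseL (η - k) (η - k') z : ℝ) : ℂ)) *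
        (F z * Φ (c + midL d z, η))) η (Pi.single j 1) =
      I * δ j * (cexp (I * ((dotR η δ + phaseL (η - k) (η - k') z : ℝ) : ℂ)) *
        (F z * Φ (c + midL d z, η))) +
      I * (cexp (I * ((dotR η δ + phaseL (η - k) (η - k') z : ℝ) : ℂ)) *
        (((z.1 j - z.2 j : ℝ) : ℂ) * F z * Φ (c + midL d z, η))) +
      cexp (I * ((dotR η δ + phaseL (η - k) (η - k') z : ℝ) : ℂ)) *
        (F z * fderiv ℝ Φ (c + midL d z, η) (dirXi j)) := by
  have hφ : ∀ η : Fin d → ℝ, dotR η δ + phaseL (η - k) (η - k') z =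
      (dotL d).flip (δ + z.1 - z.2) η - (dotR k z.1 - dotR k' z.2) := fun η => by
    rw [phaseL_apply]
    simp only [← dotL_apply, ContinuousLinearMap.flip_apply]
    simp only [map_sub, map_add, sub_apply]
    ring
  have h1 : HasFDerivAt (fun η : Fin d → ℝ => dotR η δ + phaseL (η - k) (η - k') z)
      ((dotL d).flip (δ + z.1 - z.2)) η := by
    simp only [hφ]
    exact ((dotL d).flip (δ + z.1 - z.2)).hasFDerivAt.sub_const _
  have h2 := ((ofRealCLM.hasFDerivAt.comp η h1).const_mul I).cexp
  have h3 : HasFDerivAt (fun η => Φ (c + midL d z, η)) _ η :=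
    HasFDerivAt.comp (f := fun η => (c + midL d z, η)) η
      (hΦ.differentiable (by simp) (c + midL d z, η)).hasFDerivAt
      (hasFDerivAt_prodMk_right (𝕜 := ℝ) (c + midL d z) η)
  have h4 := (h2.mul (h3.const_mul (F z))).fderiv
  have hv : (dotL d).flip (δ + z.1 - z.2) (Pi.single j 1) = δ j + z.1 j - z.2 j := by
    simp [dotL_apply, dotR, Pi.single_apply]
  have h5 := congrArg (fun T : (Fin d → ℝ) →L[ℝ] ℂ => T (Pi.single j 1)) h4
  refine h5.trans ?_
  have hx : (ContinuousLinearMap.inr ℝ (Fin d → ℝ) (Fin d → ℝ)) (Pi.single j 1) = dirXi j := rfl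
  simp only [add_apply, smul_apply, ContinuousLinearMap.comp_apply, hv, hx, smul_eq_mul,
    Function.comp_apply, ofRealCLM_apply]
  push_cast
  ring

lemma gaborIntegral_eq_setIntegral {K : Set ((Fin d → ℝ) × (Fin d → ℝ))}
    {F : (Fin d → ℝ) × (Fin d → ℝ) → ℂ} (hs : tsupport F ⊆ K)
    (Φ : (Fin d → ℝ) × (Fin d → ℝ) → ℂ) (δ c k k' η : Fin d → ℝ) :
    gaborIntegral F Φ δ c k k' η = ∫ z in K,
      cexp (I * ((dotR η δ + phaseL (η - k) (η - k') z : ℝ) : ℂ)) *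
        (F z * Φ (c + midL d z, η)) :=
  (setIntegral_eq_integral_of_forall_compl_eq_zero fun z hz => by
    rw [image_eq_zero_of_notMem_tsupport fun h => hz (hs h), zero_mul, mul_zero]).symm

lemma integral_const_mul_add_const_mul_add {X : Type*} [MeasurableSpace X] {μ : Measure X}
    {f g h : X → ℂ} (hf : Integrable f μ) (hg : Integrable g μ) (hh : Integrable h μ) (a b : ℂ) :
    ∫ x, (a * f x + b * g x + h x) ∂μ = a * ∫ x, f x ∂μ + b * ∫ x, g x ∂μ + ∫ x, h x ∂μ := by
  have hfg : Integrable (fun x => a * f x + b * g x) μ := (hf.const_mul a).add (hg.const_mul b)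
  rw [integral_add hfg hh, integral_add (hf.const_mul a) (hg.const_mul b), integral_const_mul,
    integral_const_mul]

lemma hasLineDerivAt_gaborIntegral {K : Set ((Fin d → ℝ) × (Fin d → ℝ))} (hK : IsCompact K)
    {F Φ : (Fin d → ℝ) × (Fin d → ℝ) → ℂ} (hF : ContDiff ℝ ∞ F) (hs : tsupport F ⊆ K)
    (hΦ : ContDiff ℝ ∞ Φ) (δ c k k' : Fin d → ℝ) (j : Fin d) (η : Fin d → ℝ) :
    HasLineDerivAt ℝ (gaborIntegral F Φ δ c k k')
      (I * δ j * gaborIntegral F Φ δ c k k' η +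
        I * gaborIntegral (fun z => ((z.1 j - z.2 j : ℝ) : ℂ) * F z) Φ δ c k k' η +
        gaborIntegral F (fun q => fderiv ℝ Φ q (dirXi j)) δ c k k' η) η (Pi.single j 1) := by
  have := isAddHaarMeasure_volume_prod d
  have hF' : ContDiff ℝ ∞ fun z : (Fin d → ℝ) × (Fin d → ℝ) =>
      ((z.1 j - z.2 j : ℝ) : ℂ) * F z :=
    (ofRealCLM.contDiff.comp (by fun_prop : ContDiff ℝ ∞ fun z : (Fin d → ℝ) × (Fin d → ℝ) =>
      z.1 j - z.2 j)).mul hF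
  have hs' : tsupport (fun z : (Fin d → ℝ) × (Fin d → ℝ) => ((z.1 j - z.2 j : ℝ) : ℂ) * F z) ⊆ K :=
    tsupport_mul_subset_right.trans hs
  have hΦ' : ContDiff ℝ ∞ fun q => fderiv ℝ Φ q (dirXi j) :=
    (hΦ.fderiv_right (m := ∞) (by simp)).clm_apply contDiff_const
  have hint : ∀ {F Φ : (Fin d → ℝ) × (Fin d → ℝ) → ℂ}, ContDiff ℝ ∞ F → ContDiff ℝ ∞ Φ →
      Integrable (fun z => cexp (I * ((dotR η δ + phaseL (η - k) (η - k') z : ℝ) : ℂ)) *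
        (F z * Φ (c + midL d z, η))) (volume.restrict K) := fun hF hΦ =>
    ((contDiff_gaborIntegrand hF hΦ δ c k k').continuous.comp
      (Continuous.prodMk_left η)).continuousOn.integrableOn_compact hK
  have hsm := contDiff_gaborIntegrand hF hΦ δ c k k'
  have hd := hasFDerivAt_setIntegral_of_contDiff (μ := volume) hK (H := fun z η => cexp (I * ((dotR η δ +
    phaseL (η - k) (η - k') z : ℝ) : ℂ)) * (F z * Φ (c + midL d z, η))) hsm η
  have hdi : Integrable (fun z => fderiv ℝ (fun η => cexp (I * ((dotR η δ +
      phaseL (η - k) (η - k') z : ℝ) : ℂ)) * (F z * Φ (c + midL d z, η))) η)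
      (volume.restrict K) := by
    refine (Continuous.continuousOn ?_).integrableOn_compact hK
    exact (ContDiff.fderiv (m := ∞) (n := 0) (f := fun z η => cexp (I * ((dotR η δ +
      phaseL (η - k) (η - k') z : ℝ) : ℂ)) * (F z * Φ (c + midL d z, η))) hsm contDiff_const
      (by simp)).continuous
  have heq : gaborIntegral F Φ δ c k k' = fun η => ∫ z in K,
      cexp (I * ((dotR η δ + phaseL (η - k) (η - k') z : ℝ) : ℂ)) *
        (F z * Φ (c + midL d z, η)) := funext fun η => gaborIntegral_eq_setIntegral hs Φ δ c k k' η
  rw [gaborIntegral_eq_setIntegral hs, gaborIntegral_eq_setIntegral hs,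
    gaborIntegral_eq_setIntegral hs', heq]
  have hl := hd.hasLineDerivAt (Pi.single j 1)
  rw [ContinuousLinearMap.integral_apply hdi] at hl
  simp only [fderiv_gaborIntegrand hΦ] at hl
  rwa [integral_const_mul_add_const_mul_add (hint hF hΦ) (hint hF' hΦ) (hint hF hΦ')] at hl

lemma integral_eq_zero_of_hasLineDerivAt {E : Type*} [NormedAddCommGroup E] [NormedSpace ℝ E]
    [FiniteDimensional ℝ E] [MeasurableSpace E] [BorelSpace E] {μ : Measure E}
    [μ.IsAddHaarMeasure] {f f' : E → ℂ} {v : E} (hf : Integrable f μ) (hf' : Integrable f' μ)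
    (h : ∀ x, HasLineDerivAt ℝ f (f' x) x v) : ∫ x, f' x ∂μ = 0 := by
  have := integral_bilinear_hasLineDerivAt_right_eq_neg_left_of_integrable (μ := μ)
    (f := fun _ : E => (1 : ℂ)) (f' := fun _ => 0) (g := f) (g' := f') (v := v)
    (B := ContinuousLinearMap.mul ℝ ℂ) (by simp) (by simpa using hf') (by simpa using hf)
    (fun x _ => (hasFDerivAt_const (𝕜 := ℝ) (1 : ℂ) x).hasLineDerivAt v) (fun x _ => h x)
  simpa using this

/-- Each factor `δ j` is traded for a momentum derivative of the symbol or a bounded factor of the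
amplitude. -/
lemma integral_gaborIntegral_by_parts {K : Set ((Fin d → ℝ) × (Fin d → ℝ))} (hK : IsCompact K)
    {F Φ : (Fin d → ℝ) × (Fin d → ℝ) → ℂ} (hF : ContDiff ℝ ∞ F) (hs : tsupport F ⊆ K)
    (hΦ : ContDiff ℝ ∞ Φ) (δ c k k' : Fin d → ℝ) (j : Fin d)
    (h1 : Integrable (gaborIntegral F Φ δ c k k'))
    (h2 : Integrable (gaborIntegral (fun z => ((z.1 j - z.2 j : ℝ) : ℂ) * F z) Φ δ c k k'))
    (h3 : Integrable (gaborIntegral F (fun q => fderiv ℝ Φ q (dirXi j)) δ c k k')) :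
    (δ j : ℂ) * ∫ η, gaborIntegral F Φ δ c k k' η =
      I * (∫ η, gaborIntegral F (fun q => fderiv ℝ Φ q (dirXi j)) δ c k k' η) -
        ∫ η, gaborIntegral (fun z => ((z.1 j - z.2 j : ℝ) : ℂ) * F z) Φ δ c k k' η := by
  have h := integral_eq_zero_of_hasLineDerivAt h1
    (((h1.const_mul (I * δ j)).add (h2.const_mul I)).add h3)
    fun η => hasLineDerivAt_gaborIntegral hK hF hs hΦ δ c k k' j η
  simp only [Pi.add_apply] at h
  rw [integral_const_mul_add_const_mul_add h1 h2 h3] at h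
  linear_combination (-I) * h + ((δ j : ℂ) * (∫ η, gaborIntegral F Φ δ c k k' η) +
    ∫ η, gaborIntegral (fun z => ((z.1 j - z.2 j : ℝ) : ℂ) * F z) Φ δ c k k' η) * I_sq

lemma pow_mul_norm_integral_gaborIntegral_le [Nonempty (Fin d)] {ι : Type*}
    {K : Set ((Fin d → ℝ) × (Fin d → ℝ))} (hK : IsCompact K) {m : ℕ} {W : ι → ℝ}
    (hW : ∀ i, 0 ≤ W i) {p : ℝ} {n : ℕ} (hm : n + ⌈|p|⌉₊ + (d + 1) ≤ m) (j : Fin d) (N : ℕ) :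
    ∀ {F : ι → (Fin d → ℝ) × (Fin d → ℝ) → ℂ}, SymbolBound K m W F →
      (∀ i, tsupport (F i) ⊆ K) → ∀ {Φ : (Fin d → ℝ) × (Fin d → ℝ) → ℂ}, HormClass d p Φ →
      ∃ C, 0 ≤ C ∧ ∀ i δ c k k', |δ j| ^ N *
        ((1 + ‖k - k'‖) ^ n * ‖∫ η, gaborIntegral (F i) Φ δ c k k' η‖) ≤
        C * (W i * (1 + ‖k + k'‖) ^ p) := by
  induction N with
  | zero =>
    intro F hF hs Φ hΦ
    obtain ⟨C, hC, h⟩ := norm_integral_gaborIntegral_le hK hF hW hs hΦ hm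
    refine ⟨C, hC, fun i δ c k k' => ?_⟩
    rw [pow_zero, one_mul]
    exact (h i δ c k k').2
  | succ N ih =>
    intro F hF hs Φ hΦ
    have hΦ' := hΦ.fderiv_dirXi j
    have hF' : SymbolBound K m W fun i z => ((z.1 j - z.2 j : ℝ) : ℂ) * F i z := by
      refine ((SymbolBound.of_isCompact hK (f := fun z : (Fin d → ℝ) × (Fin d → ℝ) =>
        ((z.1 j - z.2 j : ℝ) : ℂ)) (ofRealCLM.contDiff.comp (by fun_prop : ContDiff ℝ ∞
        fun z : (Fin d → ℝ) × (Fin d → ℝ) => z.1 j - z.2 j))).mul hF).mono fun i => ?_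
      rw [one_mul]
    have hs' : ∀ i, tsupport (fun z : (Fin d → ℝ) × (Fin d → ℝ) =>
        ((z.1 j - z.2 j : ℝ) : ℂ) * F i z) ⊆ K :=
      fun i => tsupport_mul_subset_right.trans (hs i)
    obtain ⟨_, -, i1⟩ := norm_integral_gaborIntegral_le hK hF hW hs hΦ hm
    obtain ⟨_, -, i2⟩ := norm_integral_gaborIntegral_le hK hF' hW hs' hΦ hm
    obtain ⟨_, -, i3⟩ := norm_integral_gaborIntegral_le hK hF hW hs hΦ' hm
    obtain ⟨C, hC, h⟩ := ih hF hs hΦ'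
    obtain ⟨C', hC', h'⟩ := ih hF' hs' hΦ
    refine ⟨C + C', by positivity, fun i δ c k k' => ?_⟩
    have key := integral_gaborIntegral_by_parts hK (hF.1 i) (hs i) hΦ.1 δ c k k' j
      (i1 i δ c k k').1 (i2 i δ c k k').1 (i3 i δ c k k').1
    have hn := congrArg norm key
    rw [norm_mul, norm_real, Real.norm_eq_abs] at hn
    have hle := hn.le.trans (norm_sub_le _ _)
    rw [norm_mul, norm_I, one_mul] at hle
    have hq : 0 ≤ |δ j| ^ N * (1 + ‖k - k'‖) ^ n := by positivity
    calc _ = |δ j| ^ N * (1 + ‖k - k'‖) ^ n *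
          (|δ j| * ‖∫ η, gaborIntegral (F i) Φ δ c k k' η‖) := by ring
      _ ≤ _ := mul_le_mul_of_nonneg_left hle hq
      _ = _ := mul_add _ _ _
      _ ≤ C * (W i * (1 + ‖k + k'‖) ^ p) + C' * (W i * (1 + ‖k + k'‖) ^ p) := by
        rw [mul_assoc, mul_assoc]
        exact add_le_add (h i δ c k k') (h' i δ c k k')
      _ = _ := by ring

end IntegrationByParts

section GaborMatrix

open Set

variable {d : ℕ}

/-- The amplitude of a magnetic Gabor matrix element in coordinates centred at `a` and `b`. -/
def gaborAmplitude (A : (Fin d → ℝ) → (Fin d → ℝ)) (g : (Fin d → ℝ) → ℝ) (a b : Fin d → ℝ)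
    (z : (Fin d → ℝ) × (Fin d → ℝ)) : ℂ :=
  cexp (-I * (brokenCirculation A a b z : ℂ)) * ((g z.1 * g z.2 : ℝ) : ℂ)

lemma dotR_dualV_div (k : Fin d → ℤ) (x : Fin d → ℝ) :
    dotR (dualV k) x / (2 * Real.pi) = dotR (zToR k) x := by
  have := Real.pi_pos
  rw [div_eq_iff (by positivity), dotR, dotR, Finset.sum_mul]
  exact Finset.sum_congr rfl fun i _ => by simp only [dualV, zToR]; ring

lemma Ifun_eq (A : (Fin d → ℝ) → (Fin d → ℝ)) (g : (Fin d → ℝ) → ℝ)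
    (Φ : ((Fin d → ℝ) × (Fin d → ℝ)) → ℂ) (α αs β βs : Fin d → ℤ) (η : Fin d → ℝ) :
    Ifun A g Φ α αs β βs η = (((2 * Real.pi) ^ d : ℝ)⁻¹ : ℂ) *
      gaborIntegral (gaborAmplitude A g (zToR α) (zToR β)) Φ (zToR α - zToR β)
        (midL d (zToR α, zToR β)) (zToR αs) (zToR βs) η := by
  have := isAddHaarMeasure_volume_prod d
  rw [Ifun, ← integral_add_left_eq_self _ (zToR α, zToR β), gaborIntegral]
  congr 2
  ext z
  have h1 : (zToR α, zToR β) + z = (zToR α + z.1, zToR β + z.2) := rfl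
  have h2 : (2 : ℝ)⁻¹ • (zToR α + z.1 + (zToR β + z.2)) =
      midL d (zToR α, zToR β) + midL d z := by
    rw [midL_apply, midL_apply, ← smul_add]
    congr 1
    abel
  have h3 : dotR η (zToR α - zToR β) + phaseL (η - zToR αs) (η - zToR βs) z =
      -dotR (zToR αs) z.1 + dotR η (zToR α + z.1 - (zToR β + z.2)) + dotR (zToR βs) z.2 := by
    rw [phaseL_apply]
    simp only [← dotL_apply, map_sub, map_add, sub_apply]
    ring
  simp only [h1, h2, h3, dotR_dualV_div, add_sub_cancel_left, gaborAmplitude, brokenCirculation,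
    ofReal_add, ofReal_neg, ofReal_mul, mul_add, Complex.exp_add]
  simp only [magPhase, segmentCirculation, neg_mul, mul_neg]
  ring

lemma tsupport_gaborAmplitude_subset {g : (Fin d → ℝ) → ℝ}
    (hg : tsupport g ⊆ univ.pi (fun _ : Fin d => Ioo (-1 : ℝ) 1))
    (A : (Fin d → ℝ) → (Fin d → ℝ)) (a b : Fin d → ℝ) :
    tsupport (gaborAmplitude A g a b) ⊆ Metric.closedBall 0 1 := by
  have h : ∀ x, g x ≠ 0 → ‖x‖ ≤ 1 := fun x hx => by
    refine (pi_norm_le_iff_of_nonneg zero_le_one).2 fun i => ?_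
    have := hg (subset_tsupport g hx) i (mem_univ i)
    exact abs_le.2 ⟨this.1.le, this.2.le⟩
  refine closure_minimal (fun z hz => ?_) Metric.isClosed_closedBall
  have hz' : g z.1 ≠ 0 ∧ g z.2 ≠ 0 := by
    simpa [gaborAmplitude, Complex.exp_ne_zero] using hz
  rw [mem_closedBall_zero_iff, Prod.norm_def]
  exact max_le (h _ hz'.1) (h _ hz'.2)

lemma symbolBound_gaborAmplitude {A : (Fin d → ℝ) → (Fin d → ℝ)} (hA : ContDiff ℝ ∞ A)
    (hB : BBounded (Bof A)) {g : (Fin d → ℝ) → ℝ} (hg : ContDiff ℝ ∞ g) {ι : Type*}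
    {K : Set ((Fin d → ℝ) × (Fin d → ℝ))} (hK : IsCompact K) (m : ℕ) (a b : ι → Fin d → ℝ) :
    SymbolBound K m (fun i => (1 + ‖a i - b i‖) ^ m)
      (fun i => gaborAmplitude A g (a i) (b i)) := by
  have h : ContDiff ℝ ∞ fun z : (Fin d → ℝ) × (Fin d → ℝ) => ((g z.1 * g z.2 : ℝ) : ℂ) :=
    ofRealCLM.contDiff.comp ((hg.comp contDiff_fst).mul (hg.comp contDiff_snd))
  refine ((symbolBound_cexp_brokenCirculation hA hB hK m a b).mul
    (SymbolBound.of_isCompact hK h)).mono fun i => ?_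
  rw [mul_one]

/-- Off-diagonal decay, in terms of sup norms, for amplitudes growing with the distance `‖δ‖`. -/
lemma gaborIntegral_decay [Nonempty (Fin d)] {ι : Type*}
    {K : Set ((Fin d → ℝ) × (Fin d → ℝ))} (hK : IsCompact K) {m : ℕ} {δ : ι → Fin d → ℝ}
    {F : ι → (Fin d → ℝ) × (Fin d → ℝ) → ℂ}
    (hF : SymbolBound K m (fun i => (1 + ‖δ i‖) ^ m) F) (hs : ∀ i, tsupport (F i) ⊆ K) {p : ℝ}
    {Φ : (Fin d → ℝ) × (Fin d → ℝ) → ℂ} (hΦ : HormClass d p Φ) {n : ℕ}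
    (hm : n + ⌈|p|⌉₊ + (d + 1) ≤ m) (N : ℕ) :
    ∃ C, 0 ≤ C ∧ ∀ i c k k', (1 + ‖δ i‖) ^ N * ((1 + ‖k - k'‖) ^ n *
      ‖∫ η, gaborIntegral (F i) Φ (δ i) c k k' η‖) ≤ C * (1 + ‖k + k'‖) ^ p := by
  have hW : ∀ i, 0 ≤ (1 + ‖δ i‖) ^ m := fun i => by positivity
  choose C hC h using fun j =>
    pow_mul_norm_integral_gaborIntegral_le hK hW hm j (N + m) hF hs hΦ
  obtain ⟨C', hC', h'⟩ := norm_integral_gaborIntegral_le hK hF hW hs hΦ hm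
  have hsum : ∀ j, C j ≤ ∑ j, C j := fun j =>
    Finset.single_le_sum (fun j _ => hC j) (Finset.mem_univ j)
  refine ⟨2 ^ (N + m - 1) * (C' + ∑ j, C j),
    mul_nonneg (by positivity) (add_nonneg hC' (Finset.sum_nonneg fun j _ => hC j)),
    fun i c k k' => ?_⟩
  obtain ⟨j, hj⟩ := exists_norm_eq_abs_apply (δ i)
  have h1 := h j i (δ i) c k k'
  have h2 := (h' i (δ i) c k k').2
  rw [← hj] at h1
  set Q := (1 + ‖k - k'‖) ^ n * ‖∫ η, gaborIntegral (F i) Φ (δ i) c k k' η‖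
  have hQ : 0 ≤ Q := by positivity
  set R := (1 + ‖k + k'‖) ^ p
  have hR : 0 ≤ R := by positivity
  have hX := norm_nonneg (δ i)
  refine le_of_mul_le_mul_left ?_ (by positivity : 0 < (1 + ‖δ i‖) ^ m)
  calc (1 + ‖δ i‖) ^ m * ((1 + ‖δ i‖) ^ N * Q) = (1 + ‖δ i‖) ^ (N + m) * Q := by ring
    _ ≤ 2 ^ (N + m - 1) * (1 ^ (N + m) + ‖δ i‖ ^ (N + m)) * Q :=
      mul_le_mul_of_nonneg_right (add_pow_le zero_le_one hX _) hQ
    _ = 2 ^ (N + m - 1) * (Q + ‖δ i‖ ^ (N + m) * Q) := by rw [one_pow]; ring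
    _ ≤ 2 ^ (N + m - 1) * (C' * ((1 + ‖δ i‖) ^ m * R) + C j * ((1 + ‖δ i‖) ^ m * R)) := by
      gcongr
    _ ≤ 2 ^ (N + m - 1) * (C' * ((1 + ‖δ i‖) ^ m * R) +
        (∑ j, C j) * ((1 + ‖δ i‖) ^ m * R)) := by
      gcongr
      exact hsum j
    _ = _ := by ring

lemma jap_smul_le {t : ℝ} (ht : 1 ≤ t) (x : Fin d → ℝ) :
    jap (t • x) ≤ (2 + d) * t * (1 + ‖x‖) := by
  refine (jap_le_one_add_norm _).trans ?_
  rw [norm_smul, Real.norm_of_nonneg (by linarith), mul_assoc]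
  have := norm_nonneg x
  gcongr
  nlinarith

lemma jap_smul_rpow_le {t : ℝ} (ht : 1 ≤ t) (x : Fin d → ℝ) (p : ℝ) :
    jap (t • x) ^ p ≤ ((2 + d) * t) ^ |p| * (1 + ‖x‖) ^ p := by
  have ht0 : 0 < t := by linarith
  refine rpow_le_of_comparable (jap_pos _) (by positivity) (by positivity) (jap_smul_le ht x) ?_ p
  have hx := norm_nonneg x
  have h := one_add_norm_le_jap (t • x)
  rw [norm_smul, Real.norm_of_nonneg ht0.le] at h
  calc 1 + ‖x‖ ≤ 1 + t * ‖x‖ := by nlinarith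
    _ ≤ (2 + d) * 1 * jap (t • x) := by rwa [mul_one]
    _ ≤ (2 + d) * t * jap (t • x) := by
      have := (jap_pos (t • x)).le
      gcongr

end GaborMatrix

/-- **Theorem 3.1, (i) ⇒ (ii)**: if `Φ ∈ S^p_0(ℝ^{2d})`, then the Gabor matrix elements
`M_{aa,bb} = ∫ I_{aa,bb}(η) dη` of `Op^A(Φ)` are well defined (the `η`-integrand is
integrable) and satisfy, for every `(n₁,n₂) ∈ ℕ²`, the off-diagonal decay
`⟨α−β⟩^{n₁} ⟨α*−β*⟩^{n₂} ⟨α*+β*⟩^{−p} |M_{aa,bb}| ≤ C(n₁,n₂)` (with `α* = 2πk`, etc.). -/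
theorem gabor_matrix_decay_of_hormander (d : ℕ) (hd : 1 ≤ d) (p : ℝ)
    (A : (Fin d → ℝ) → (Fin d → ℝ)) (hA : Function.HasTemperateGrowth A)
    (hB : BBounded (Bof A))
    (g : (Fin d → ℝ) → ℝ) (hg : IsQuadPartition g)
    (Φ : ((Fin d → ℝ) × (Fin d → ℝ)) → ℂ) (hΦ : HormClass d p Φ) :
    (∀ α αs β βs : Fin d → ℤ, Integrable (fun η : Fin d → ℝ => Ifun A g Φ α αs β βs η)) ∧
    ∀ n₁ n₂ : ℕ, ∃ C : ℝ, 0 < C ∧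
      ∀ α αs β βs : Fin d → ℤ,
        jap (zToR α - zToR β) ^ n₁ * jap (dualV αs - dualV βs) ^ n₂ *
            jap (dualV αs + dualV βs) ^ (-p) *
            ‖∫ η : Fin d → ℝ, Ifun A g Φ α αs β βs η‖ ≤ C := by
  have : Nonempty (Fin d) := ⟨⟨0, hd⟩⟩
  have hK : IsCompact (Metric.closedBall (0 : (Fin d → ℝ) × (Fin d → ℝ)) 1) :=
    isCompact_closedBall _ _
  have hF := fun m => symbolBound_gaborAmplitude hA.1 hB hg.1 hK m
    (fun i : (Fin d → ℤ) × (Fin d → ℤ) => zToR i.1) (fun i => zToR i.2)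
  have hs := fun i : (Fin d → ℤ) × (Fin d → ℤ) =>
    tsupport_gaborAmplitude_subset hg.2.2.1 A (zToR i.1) (zToR i.2)
  refine ⟨fun α αs β βs => ?_, fun n₁ n₂ => ?_⟩
  · obtain ⟨C, -, h⟩ := norm_integral_gaborIntegral_le hK (hF _) (fun i => by positivity) hs hΦ
      (n := 0) le_rfl
    simp only [Ifun_eq]
    exact (h (α, β) _ _ _ _).1.const_mul _
  obtain ⟨C, hC, h⟩ := gaborIntegral_decay hK (hF _) hs hΦ (n := n₂) le_rfl n₁
  have hpi : 1 ≤ 2 * Real.pi := by linarith [Real.two_le_pi]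
  set V : ℝ := ((2 * Real.pi) ^ d)⁻¹
  have hV : 0 ≤ V := by positivity
  set c₁ : ℝ := 2 + d
  set c₂ : ℝ := c₁ * (2 * Real.pi)
  have hc₁ : 0 ≤ c₁ := by positivity
  have hc₂ : 0 ≤ c₂ := by positivity
  refine ⟨c₁ ^ n₁ * c₂ ^ n₂ * c₂ ^ |p| * (V * C) + 1, by positivity, fun α αs β βs => ?_⟩
  have hsub : dualV αs - dualV βs = (2 * Real.pi) • (zToR αs - zToR βs) :=
    funext fun i => (mul_sub _ _ _).symm
  have hadd : dualV αs + dualV βs = (2 * Real.pi) • (zToR αs + zToR βs) :=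
    funext fun i => (mul_add _ _ _).symm
  have h₁ := jap_le_one_add_norm (zToR α - zToR β)
  have h₂ := jap_smul_le hpi (zToR αs - zToR βs)
  have h₃ := jap_smul_rpow_le hpi (zToR αs + zToR βs) (-p)
  have h₄ := h (α, β) (midL d (zToR α, zToR β)) (zToR αs) (zToR βs)
  rw [abs_neg] at h₃
  simp only [Ifun_eq]
  rw [integral_const_mul, norm_mul, hsub, hadd]
  have hVn : ‖(((2 * Real.pi) ^ d : ℝ)⁻¹ : ℂ)‖ = V := by
    rw [← ofReal_inv, norm_real, Real.norm_of_nonneg hV]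
  rw [hVn]
  set T := ‖∫ η, gaborIntegral (gaborAmplitude A g (zToR α) (zToR β)) Φ (zToR α - zToR β)
    (midL d (zToR α, zToR β)) (zToR αs) (zToR βs) η‖
  set s := 1 + ‖zToR αs + zToR βs‖
  have hs0 : 0 < s := by positivity
  have hj₁ := (jap_pos (zToR α - zToR β)).le
  have hj₂ := (jap_pos ((2 * Real.pi) • (zToR αs - zToR βs))).le
  have hj₃ := Real.rpow_nonneg (jap_pos ((2 * Real.pi) • (zToR αs + zToR βs))).le (-p)
  calc _ ≤ (c₁ * (1 + ‖zToR α - zToR β‖)) ^ n₁ * (c₂ * (1 + ‖zToR αs - zToR βs‖)) ^ n₂ *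
        (c₂ ^ |p| * s ^ (-p)) * (V * T) := by
        gcongr
    _ = c₁ ^ n₁ * c₂ ^ n₂ * c₂ ^ |p| * V * s ^ (-p) * ((1 + ‖zToR α - zToR β‖) ^ n₁ *
        ((1 + ‖zToR αs - zToR βs‖) ^ n₂ * T)) := by
        rw [mul_pow c₁, mul_pow c₂]
        ring
    _ ≤ c₁ ^ n₁ * c₂ ^ n₂ * c₂ ^ |p| * V * s ^ (-p) * (C * s ^ p) := by
        gcongr
    _ = c₁ ^ n₁ * c₂ ^ n₂ * c₂ ^ |p| * (V * C) * (s ^ (-p) * s ^ p) := by ring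
    _ = c₁ ^ n₁ * c₂ ^ n₂ * c₂ ^ |p| * (V * C) := by
        rw [← Real.rpow_add hs0, neg_add_cancel, Real.rpow_zero, mul_one]
    _ ≤ _ := le_add_of_nonneg_right zero_le_one
end
end
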